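/- Let S be a countable set of positive reals having 0 as an accumulation point. Let G = iso(U_S) be the group of bijective self-isometries of U_S with the topology of pointwise convergence on the metric space U_S, and let cLO(U_S) be the compact space of convex linear orderings of U_S (as a subspace of 2^{U_S × U_S}), with the continuous action of G given by x <^g y iff g^{-1}(x) < g^{-1}(y). Then cLO(U_S) is the universal minimal flow of G: this action is minimal, and for every compact Hausdorff space X with a continuous minimal action of G there is a continuous G-equivariant surjection from cLO(U_S) onto X. -/

import Mathlib

open Classical

/-- Membership in `U_S` : the support of `x : S → ℚ` is contained in the range of some
strictly decreasing sequence of elements of `S` converging to `0`. -/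
def USsupp (S : Set ℝ) (x : S → ℚ) : Prop :=
  ∃ f : ℕ → ℝ, StrictAnti f ∧ (∀ i, f i ∈ S) ∧
    Filter.Tendsto f Filter.atTop (nhds 0) ∧
    ∀ s : S, x s ≠ 0 → ∃ i, (s : ℝ) = f i

/-- The space `U_S`, completion of `Q_S`. -/
def US (S : Set ℝ) := {x : S → ℚ // USsupp S x}

/-- The distance on `U_S` : `d x y = min {s ∈ S | x and y agree above s}` for `x ≠ y`,
and `d x x = 0`. -/
noncomputable def dU (S : Set ℝ) (x y : US S) : ℝ :=
  if x = y then 0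
  else sInf {r : ℝ | r ∈ S ∧ ∀ t : S, r < (t : ℝ) → x.1 t = y.1 t}

/-- `r` is a strict total order (irreflexive, transitive, trichotomous). -/
def IsSTO {X : Type*} (r : X → X → Prop) : Prop :=
  (∀ x, ¬ r x x) ∧ (∀ x y z, r x y → r y z → r x z) ∧ (∀ x y, r x y ∨ x = y ∨ r y x)

/-- `r` is a convex linear ordering with respect to the distance `d` : a strict total
order for which every closed metric ball is an interval (equivalently,
`r x y → r y z → d x y ≤ d x z ∧ d y z ≤ d x z`). -/
def IsConvexSTO {X : Type*} (d : X → X → ℝ) (r : X → X → Prop) : Prop :=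
  IsSTO r ∧ ∀ x y z, r x y → r y z → d x y ≤ d x z ∧ d y z ≤ d x z

/-- The group `iso(U_S)` of bijective self-isometries of `U_S`. -/
def IsoU (S : Set ℝ) := {g : US S ≃ US S // ∀ x y, dU S (g x) (g y) = dU S x y}

/-- The space `cLO(U_S)` of convex linear orderings of `U_S` (as Boolean relations),
a subspace of `2^{U_S × U_S}` with the product topology. -/
def cLOU (S : Set ℝ) :=
  {r : US S → US S → Bool // IsConvexSTO (dU S) (fun x y => r x y = true)}

instance (S : Set ℝ) : TopologicalSpace (cLOU S) :=
  inferInstanceAs (TopologicalSpace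
    {r : US S → US S → Bool // IsConvexSTO (dU S) (fun x y => r x y = true)})

/-- The action of `iso(U_S)` on `cLO(U_S)` : `x <^g y` iff `g⁻¹ x < g⁻¹ y`. -/
def actU (S : Set ℝ) (g : IsoU S) (r : cLOU S) : cLOU S :=
  ⟨fun x y => r.1 (g.1.symm x) (g.1.symm y), by
    obtain ⟨⟨hirr, htr, htri⟩, hconv⟩ := r.2
    have e : ∀ a b : US S, dU S (g.1.symm a) (g.1.symm b) = dU S a b := by
      intro a b
      have := g.2 (g.1.symm a) (g.1.symm b)
      simpa using this.symm
    refine ⟨⟨fun x => hirr _, fun x y z hxy hyz => htr _ _ _ hxy hyz, fun x y => ?_⟩,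
      fun x y z hxy hyz => ?_⟩
    · rcases htri (g.1.symm x) (g.1.symm y) with h | h | h
      · exact Or.inl h
      · exact Or.inr (Or.inl (g.1.symm.injective h))
      · exact Or.inr (Or.inr h)
    · have h := hconv _ _ _ hxy hyz
      simpa only [e] using h⟩

instance (S : Set ℝ) : Group (IsoU S) where
  mul g h := ⟨h.1.trans g.1,
    fun x y => by simp only [Equiv.trans_apply]; rw [g.2, h.2]⟩
  one := ⟨Equiv.refl _, fun x y => rfl⟩
  inv g := ⟨g.1.symm,
    fun x y => by have := g.2 (g.1.symm x) (g.1.symm y); simpa using this.symm⟩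
  mul_assoc a b c := Subtype.ext (Equiv.ext fun x => rfl)
  one_mul a := Subtype.ext (Equiv.ext fun x => rfl)
  mul_one a := Subtype.ext (Equiv.ext fun x => rfl)
  inv_mul_cancel g := Subtype.ext (Equiv.ext fun x => g.1.symm_apply_apply x)

/-- `U_S` carries the metric topology of `dU`. -/
instance (S : Set ℝ) : TopologicalSpace (US S) :=
  TopologicalSpace.generateFrom
    {B : Set (US S) | ∃ x ε, 0 < ε ∧ B = {y | dU S x y < ε}}

/-- `iso(U_S)` carries the topology of pointwise convergence on the metric space
`U_S` (for the group and its inverses). -/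
instance (S : Set ℝ) : TopologicalSpace (IsoU S) :=
  TopologicalSpace.induced
    (fun g : IsoU S => ((g.1 : US S → US S), (g.1.symm : US S → US S)))
    inferInstance

/-- Every finite partial order isomorphism of `ℚ` extends to an order automorphism. -/
theorem Order.PartialIso.exists_orderIso_rat (f : Order.PartialIso ℚ ℚ) :
    ∃ σ : ℚ ≃o ℚ, ∀ p ∈ f.1, σ p.1 = p.2 := by
  let D : ℚ ⊕ ℚ → Order.Cofinal (Order.PartialIso ℚ ℚ) := fun p =>
    Sum.recOn p (Order.PartialIso.definedAtLeft ℚ) (Order.PartialIso.definedAtRight ℚ)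
  let I : Order.Ideal (Order.PartialIso ℚ ℚ) := Order.idealOfCofinals f D
  let F a := Order.PartialIso.funOfIdeal a I (Order.cofinal_meets_idealOfCofinals _ D (Sum.inl a))
  let G b := Order.PartialIso.invOfIdeal b I (Order.cofinal_meets_idealOfCofinals _ D (Sum.inr b))
  refine ⟨OrderIso.ofCmpEqCmp (fun a => (F a).val) (fun b => (G b).val) fun a b => ?_,
    fun p hp => ?_⟩
  · rcases (F a).prop with ⟨f, hf, ha⟩
    rcases (G b).prop with ⟨g, hg, hb⟩
    rcases I.directed _ hf _ hg with ⟨m, _, fm, gm⟩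
    exact m.prop (a, _) (fm ha) (_, b) (gm hb)
  · rcases (F p.1).prop with ⟨g, hg, ha⟩
    rcases I.directed _ hg _ (Order.mem_idealOfCofinals f D) with ⟨m, _, gm, fm⟩
    have h := m.prop (p.1, _) (gm ha) p (fm hp)
    rw [cmp_self_eq_eq] at h
    exact (cmp_eq_eq_iff _ _).1 h.symm

theorem exists_orderIso_rat_image_eq {T A : Finset ℚ} (h : T.card = A.card) :
    ∃ σ : ℚ ≃o ℚ, T.image σ = A := by
  obtain ⟨σ, hσ⟩ := Order.PartialIso.exists_orderIso_rat
    ⟨Finset.univ.image fun i => (T.orderEmbOfFin h i, A.orderEmbOfFin rfl i), by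
      intro p hp q hq
      simp only [Finset.mem_image, Finset.mem_univ, true_and] at hp hq
      obtain ⟨i, rfl⟩ := hp
      obtain ⟨j, rfl⟩ := hq
      simp only
      rw [(T.orderEmbOfFin h).strictMono.cmp_map_eq, (A.orderEmbOfFin rfl).strictMono.cmp_map_eq]⟩
  refine ⟨σ, Finset.eq_of_subset_of_card_le ?_ ?_⟩
  · intro y hy
    obtain ⟨x, hx, rfl⟩ := Finset.mem_image.1 hy
    have : x ∈ Set.range (T.orderEmbOfFin h) := by simpa using hx
    obtain ⟨i, rfl⟩ := this
    rw [hσ (T.orderEmbOfFin h i, A.orderEmbOfFin rfl i) (by simp)]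
    exact Finset.orderEmbOfFin_mem _ _ _
  · rw [Finset.card_image_of_injective _ σ.injective, h]

theorem exists_orderIso_rat_fixing (Q : Finset ℚ) (u v : ℚ) (h : ∀ q ∈ Q, q < u ↔ q < v)
    (h' : ∀ q ∈ Q, u < q ↔ v < q) : ∃ σ : ℚ ≃o ℚ, σ u = v ∧ ∀ q ∈ Q, σ q = q := by
  have hc : ∀ q ∈ Q, cmp q u = cmp q v := by
    intro q hq
    rcases lt_trichotomy q u with hl | he | hl
    · rw [(cmp_eq_lt_iff _ _).2 hl, (cmp_eq_lt_iff _ _).2 ((h q hq).1 hl)]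
    · have h1 := h q hq
      have h2 := h' q hq
      have : q = v := le_antisymm (not_lt.1 fun hv => (h2.2 hv).ne he.symm)
        (not_lt.1 fun hv => (h1.2 hv).ne he)
      rw [← this, ← he]
    · rw [(cmp_eq_gt_iff _ _).2 hl, (cmp_eq_gt_iff _ _).2 ((h' q hq).1 hl)]
  obtain ⟨σ, hσ⟩ := Order.PartialIso.exists_orderIso_rat
    ⟨insert (u, v) (Q.image fun q => (q, q)), by
      intro p hp q hq
      simp only [Finset.mem_insert, Finset.mem_image] at hp hq
      rcases hp with rfl | ⟨p, hp, rfl⟩ <;> rcases hq with rfl | ⟨q, hq, rfl⟩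
      · simp
      · have := hc q hq
        rwa [cmp_eq_cmp_symm] at this
      · exact hc p hp
      · rfl⟩
  exact ⟨σ, hσ (u, v) (by simp), fun q hq => hσ (q, q) (by simp [hq])⟩

theorem OrderIso.apply_eq_of_image_eq {A : Finset ℚ} {σ : ℚ ≃o ℚ} (h : A.image σ = A) {a : ℚ}
    (ha : a ∈ A) : σ a = a := by
  have : a ∈ Set.range (A.orderEmbOfFin rfl) := by simpa using ha
  obtain ⟨i, rfl⟩ := this
  have hu := Finset.orderEmbOfFin_unique (s := A) rfl (f := fun i => σ (A.orderEmbOfFin rfl i))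
    (fun i => by
      have h2 : σ (A.orderEmbOfFin rfl i) ∈ A.image σ :=
        Finset.mem_image_of_mem _ (Finset.orderEmbOfFin_mem _ _ _)
      rwa [h] at h2)
    (σ.strictMono.comp (A.orderEmbOfFin rfl).strictMono)
  exact congrFun hu i

/-- A compact-valued form of the finite Ramsey theorem: some point is such that each of its
neighbourhoods contains the values of `c` on all `n`-subsets of arbitrarily large finite sets. -/
theorem exists_ramsey_limit {X : Type*} [TopologicalSpace X] [CompactSpace X]
    (c : Finset ℕ → X) (n : ℕ) :
    ∃ x₀, ∀ O : Set X, IsOpen O → x₀ ∈ O → ∀ N, ∃ B : Finset ℕ, B.card = N ∧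
      ∀ T ⊆ B, T.card = n → c T ∈ O := by
  let 𝒰 : Ultrafilter ℕ := Filter.hyperfilter ℕ
  have hstep : ∀ d : Finset ℕ → X, ∃ d' : Finset ℕ → X,
      ∀ T, Filter.Tendsto (fun b => d (insert b T)) 𝒰 (nhds (d' T)) := by
    intro d
    refine ⟨fun T => (𝒰.map fun b => d (insert b T)).lim, fun T => ?_⟩
    exact (𝒰.map fun b => d (insert b T)).le_nhds_lim
  choose Φ hΦ using hstep
  let L : ℕ → Finset ℕ → X := fun k => Φ^[k] c
  have hL : ∀ k T, Filter.Tendsto (fun b => L k (insert b T)) 𝒰 (nhds (L (k + 1) T)) := by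
    intro k T
    simp only [L, Function.iterate_succ_apply']
    exact hΦ _ T
  refine ⟨L n ∅, fun O hO hx N => ?_⟩
  suffices H : ∃ B : Finset ℕ, B.card = N ∧ ∀ T ⊆ B, T.card ≤ n → L (n - T.card) T ∈ O by
    obtain ⟨B, hB, h⟩ := H
    refine ⟨B, hB, fun T hT hn => ?_⟩
    have := h T hT hn.le
    rwa [hn, Nat.sub_self] at this
  induction N with
  | zero => exact ⟨∅, rfl, fun T hT _ => by rw [Finset.subset_empty.1 hT]; simpa using hx⟩
  | succ N ih =>
    obtain ⟨B, hB, h⟩ := ih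
    have h1 : ∀ᶠ b in (𝒰 : Filter ℕ), ∀ T ∈ B.powerset, T.card < n →
        L (n - T.card - 1) (insert b T) ∈ O := by
      rw [Filter.eventually_all_finset]
      intro T hT
      rw [Filter.eventually_imp_distrib_left]
      intro hn
      refine (hL (n - T.card - 1) T).eventually (hO.mem_nhds ?_)
      have := h T (Finset.mem_powerset.1 hT) hn.le
      rwa [show n - T.card - 1 + 1 = n - T.card by omega]
    have h2 : ∀ᶠ b in (𝒰 : Filter ℕ), b ∉ B :=
      Filter.compl_mem_hyperfilter_of_finite B.finite_toSet
    obtain ⟨b, hb1, hb2⟩ := (h1.and h2).exists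
    refine ⟨insert b B, by rw [Finset.card_insert_of_notMem hb2, hB], fun T hT hn => ?_⟩
    by_cases hbT : b ∈ T
    · have hsub : T.erase b ⊆ B := by
        intro t ht
        rcases Finset.mem_insert.1 (hT (Finset.mem_of_mem_erase ht)) with h | h
        · exact absurd h (Finset.ne_of_mem_erase ht)
        · exact h
      have hcard := Finset.card_erase_add_one hbT
      have := hb1 (T.erase b) (Finset.mem_powerset.2 hsub) (by omega)
      rw [Finset.insert_erase hbT] at this
      rwa [show n - (T.erase b).card - 1 = n - T.card by omega] at this
    · refine h T (fun t ht => ?_) hn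
      rcases Finset.mem_insert.1 (hT ht) with h | h
      · exact absurd (h ▸ ht) hbT
      · exact h

/-- On a compact space, approximate common fixed points yield a common fixed point. -/
theorem exists_common_fixed_of_approx {X ι : Type*} [UniformSpace X] [CompactSpace X] [T2Space X]
    {Y : Set X} (hY : IsClosed Y) (m : ι → X → X) (hm : ∀ i, Continuous (m i))
    (h : ∀ E ∈ uniformity X, ∀ F : Finset ι, ∃ x ∈ Y, ∀ i ∈ F, (m i x, x) ∈ E) :
    ∃ x ∈ Y, ∀ i, m i x = x := by
  let t : {E : Set (X × X) // E ∈ uniformity X ∧ IsClosed E} × ι → Set X :=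
    fun q => {x | (m q.2 x, x) ∈ q.1.1}
  have := hY.isCompact.inter_iInter_nonempty t
    (fun q => q.1.2.2.preimage ((hm q.2).prodMk continuous_id)) (fun u => by
      obtain ⟨x, hx, hf⟩ := h (⋂ q ∈ u, q.1.1)
        ((Filter.biInter_finset_mem u).2 fun q _ => q.1.2.1) (u.image Prod.snd)
      refine ⟨x, hx, Set.mem_iInter₂.2 fun q hq => ?_⟩
      exact Set.mem_iInter₂.1 (hf q.2 (Finset.mem_image_of_mem _ hq)) q hq)
  obtain ⟨x, hx, ht⟩ := this
  refine ⟨x, hx, fun i => eq_of_uniformity_basis uniformity_hasBasis_closed fun {E} hE => ?_⟩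
  exact Set.mem_iInter.1 ht (⟨E, hE⟩, i)

/-- Extreme amenability of the order automorphism group of `ℚ`. -/
theorem exists_fixed_of_rat_orderIso_action {X : Type*} [UniformSpace X] [CompactSpace X]
    [T2Space X] {Y : Set X} (hY : IsClosed Y) (hne : Y.Nonempty) (m : (ℚ ≃o ℚ) → X → X)
    (hm : ∀ σ, Continuous (m σ)) (hmul : ∀ σ τ x, m (σ * τ) x = m σ (m τ x))
    (hinv : ∀ σ, ∀ x ∈ Y, m σ x ∈ Y)
    (hunif : ∀ E ∈ uniformity X, ∃ A : Finset ℚ, ∀ σ : ℚ ≃o ℚ, (∀ a ∈ A, σ a = a) →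
      ∀ x, (m σ x, x) ∈ E) :
    ∃ x ∈ Y, ∀ σ, m σ x = x := by
  refine exists_common_fixed_of_approx hY m hm fun E hE F => ?_
  obtain ⟨E₁, hE₁, hsymm, hcomp⟩ := comp_symm_mem_uniformity_sets hE
  obtain ⟨E₂, hE₂, hsymm₂, hcomp₂⟩ := comp_symm_mem_uniformity_sets hE₁
  obtain ⟨A, hA⟩ := hunif E₂ hE₂
  obtain ⟨y, hy⟩ := hne
  let ν : Finset ℕ → Finset ℚ := fun T => T.image (fun k : ℕ => (k : ℚ))
  have hν : ∀ T, (ν T).card = T.card := fun T =>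
    Finset.card_image_of_injective _ Nat.cast_injective
  have hg : ∀ T : Finset ℕ, ∃ σ : ℚ ≃o ℚ, T.card = A.card → (ν T).image σ = A := by
    intro T
    by_cases h : T.card = A.card
    · obtain ⟨σ, hσ⟩ := exists_orderIso_rat_image_eq ((hν T).trans h)
      exact ⟨σ, fun _ => hσ⟩
    · exact ⟨1, fun h' => absurd h' h⟩
  choose g hg using hg
  obtain ⟨x₀, hx₀⟩ := exists_ramsey_limit (fun T => m (g T) y) A.card
  let F' := insert 1 F
  let B : Finset ℚ := F'.biUnion fun f => A.image f.symm
  obtain ⟨C, hC, hCO⟩ := hx₀ (interior {x | (x, x₀) ∈ E₂}) isOpen_interior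
    (mem_interior_iff_mem_nhds.2 (mem_nhds_right _ hE₂)) B.card
  obtain ⟨w, hw⟩ := exists_orderIso_rat_image_eq ((hν C).trans hC)
  have key : ∀ f ∈ F', (m f (m w y), x₀) ∈ E₁ := by
    intro f hf
    let T := C.filter fun k : ℕ => f (w k) ∈ A
    have hT : (ν T).image (f * w) = A := by
      ext a
      simp only [ν, T, Finset.mem_image, Finset.mem_filter]
      constructor
      · rintro ⟨_, ⟨k, ⟨_, hk⟩, rfl⟩, rfl⟩
        exact hk
      · intro ha
        have : f.symm a ∈ (ν C).image w := by
          rw [hw]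
          exact Finset.mem_biUnion.2 ⟨f, hf, Finset.mem_image_of_mem _ ha⟩
        obtain ⟨_, hq, hwq⟩ := Finset.mem_image.1 this
        obtain ⟨k, hk, rfl⟩ := Finset.mem_image.1 hq
        have hfa : f (w k) = a := by rw [hwq]; exact f.apply_symm_apply a
        exact ⟨_, ⟨k, ⟨hk, by rwa [hfa]⟩, rfl⟩, hfa⟩
    have hTc : T.card = A.card := by
      rw [← hν, ← hT, Finset.card_image_of_injective _ (f * w).injective]
    have hgT := hg T hTc
    have h1 : (m (g T) y, x₀) ∈ E₂ :=
      interior_subset (s := {x | (x, x₀) ∈ E₂}) (hCO T (Finset.filter_subset _ _) hTc)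
    have h2 : (m ((f * w) * (g T)⁻¹) (m (g T) y), m (g T) y) ∈ E₂ := by
      refine hA _ (fun a ha => OrderIso.apply_eq_of_image_eq (A := A) ?_ ha) _
      have : A.image ⇑(g T)⁻¹ = ν T := by
        have hid : ⇑(g T)⁻¹ ∘ ⇑(g T) = id := funext fun q => (g T).symm_apply_apply q
        rw [← hgT, Finset.image_image, hid, Finset.image_id]
      rw [RelIso.coe_mul, ← Finset.image_image, this, hT]
    rw [← hmul, inv_mul_cancel_right, hmul] at h2
    exact hcomp₂ (SetRel.prodMk_mem_comp h2 h1)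
  refine ⟨m w y, hinv _ _ hy, fun f hf => ?_⟩
  have h1 := key f (Finset.mem_insert_of_mem hf)
  have h2 := key 1 (Finset.mem_insert_self _ _)
  rw [← hmul, one_mul] at h2
  exact hcomp (SetRel.prodMk_mem_comp h1 (hsymm.symm _ _ h2))

theorem USsupp.finite {S : Set ℝ} {x : S → ℚ} (h : USsupp S x) {ε : ℝ} (hε : 0 < ε) :
    {t : S | ε ≤ t ∧ x t ≠ 0}.Finite := by
  obtain ⟨f, -, -, hf, hx⟩ := h
  obtain ⟨N, hN⟩ := Filter.eventually_atTop.1 (hf.eventually (gt_mem_nhds hε))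
  refine (((Set.finite_Iio N).image f).preimage Subtype.val_injective.injOn).subset ?_
  rintro t ⟨ht, hxt⟩
  obtain ⟨i, hi⟩ := hx t hxt
  refine ⟨i, ?_, hi.symm⟩
  by_contra hiN
  exact absurd (hN i (not_lt.1 hiN)) (not_lt.2 (hi ▸ ht))

theorem USsupp.of_finite {S : Set ℝ} (hSpos : ∀ s ∈ S, 0 < s) (hacc : ∀ ε > 0, ∃ s ∈ S, s < ε)
    {x : S → ℚ} (h : ∀ ε > (0 : ℝ), {t : S | ε ≤ t ∧ x t ≠ 0}.Finite) : USsupp S x := by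
  have hseq : ∀ n : ℕ, ∃ s ∈ S, s < 1 / ((n : ℝ) + 1) := fun n => hacc _ (by positivity)
  choose e heS he using hseq
  let Z : Set ℝ := Subtype.val '' {t : S | x t ≠ 0} ∪ Set.range e
  have hZS : Z ⊆ S := by
    rintro z (⟨t, -, rfl⟩ | ⟨n, rfl⟩)
    exacts [t.2, heS n]
  have hZfin : ∀ ε > 0, (Z ∩ Set.Ici ε).Finite := by
    intro ε hε
    obtain ⟨N, hN⟩ := exists_nat_gt (1 / ε)
    refine (((h ε hε).image Subtype.val).union ((Set.finite_Iio N).image e)).subset ?_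
    rintro z ⟨⟨t, ht, rfl⟩ | ⟨n, rfl⟩, hz⟩
    · exact Or.inl ⟨t, ⟨hz, ht⟩, rfl⟩
    · refine Or.inr ⟨n, ?_, rfl⟩
      have h1 : ε < 1 / ((n : ℝ) + 1) := lt_of_le_of_lt hz (he n)
      have h2 : (n : ℝ) + 1 < 1 / ε := by
        rw [lt_div_iff₀ (by positivity)] at h1 ⊢
        linarith
      have : (n : ℝ) < N := by linarith
      exact_mod_cast this
  have hZacc : ∀ ε > 0, ∃ z ∈ Z, z < ε := by
    intro ε hε
    obtain ⟨n, hn⟩ := exists_nat_one_div_lt hε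
    exact ⟨e n, Or.inr ⟨n, rfl⟩, (he n).trans hn⟩
  have hnext : ∀ ε : ℝ, ∃ z, 0 < ε → z ∈ Z ∧ z < ε ∧ ∀ z' ∈ Z, z' < ε → z' ≤ z := by
    intro ε
    by_cases hε : 0 < ε
    · obtain ⟨z₀, hz₀, hlt⟩ := hZacc ε hε
      obtain ⟨z, hz, hmax⟩ := Set.exists_max_image _ id
        ((hZfin z₀ (hSpos _ (hZS hz₀))).inter_of_left (Set.Iio ε))
        ⟨z₀, ⟨hz₀, Set.mem_Ici.2 le_rfl⟩, hlt⟩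
      refine ⟨z, fun _ => ⟨hz.1.1, hz.2, fun z' hz' hlt' => ?_⟩⟩
      by_cases hle : z₀ ≤ z'
      · exact hmax z' ⟨⟨hz', hle⟩, hlt'⟩
      · exact (not_le.1 hle).le.trans hz.1.2
    · exact ⟨0, fun h => absurd h hε⟩
  choose next hnext using hnext
  obtain ⟨M, hM⟩ := (hZfin 1 one_pos).bddAbove
  let f : ℕ → ℝ := fun n => next^[n + 1] (max M 1 + 1)
  have hM' : ∀ z ∈ Z, z < max M 1 + 1 := by
    intro z hz
    by_cases h1 : 1 ≤ z
    · have := hM ⟨hz, h1⟩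
      linarith [le_max_left M 1]
    · linarith [le_max_right M 1]
  have hM0 : 0 < max M 1 + 1 := by linarith [le_max_right M 1]
  have hfZ : ∀ n, f n ∈ Z := by
    intro n
    induction n with
    | zero => exact (hnext _ hM0).1
    | succ n ih =>
      simp only [f, Function.iterate_succ_apply'] at ih ⊢
      exact (hnext _ (hSpos _ (hZS ih))).1
  have hfsucc : ∀ n, f (n + 1) < f n ∧ ∀ z' ∈ Z, z' < f n → z' ≤ f (n + 1) := by
    intro n
    have h1 := (hnext _ (hSpos _ (hZS (hfZ n)))).2
    have h2 : next (f n) = f (n + 1) := by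
      simp only [f, Function.iterate_succ_apply']
    rwa [h2] at h1
  have hanti : StrictAnti f := strictAnti_nat_of_succ_lt fun n => (hfsucc n).1
  have hlt : ∀ ε > 0, ∃ n, f n < ε := by
    intro ε hε
    by_contra! hcon
    exact Set.infinite_of_injective_forall_mem (s := Z ∩ Set.Ici ε) hanti.injective
      (fun n => ⟨hfZ n, hcon n⟩) (hZfin ε hε)
  refine ⟨f, hanti, fun i => hZS (hfZ i), ?_, fun s hs => ?_⟩
  · rw [Metric.tendsto_atTop]
    intro ε hε
    obtain ⟨N, hN⟩ := hlt ε hε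
    refine ⟨N, fun n hn => ?_⟩
    rw [Real.dist_eq, sub_zero, abs_of_pos (hSpos _ (hZS (hfZ n)))]
    exact (hanti.antitone hn).trans_lt hN
  · have hsZ : (s : ℝ) ∈ Z := Or.inl ⟨s, hs, rfl⟩
    by_contra! hcon
    have hle : ∀ n, (s : ℝ) < f n := by
      intro n
      induction n with
      | zero => exact lt_of_le_of_ne ((hnext _ hM0).2.2 _ hsZ (hM' _ hsZ)) (hcon 0)
      | succ n ih => exact lt_of_le_of_ne ((hfsucc n).2 _ hsZ ih) (hcon _)
    obtain ⟨n, hn⟩ := hlt s (hSpos _ s.2)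
    exact absurd hn (hle n).le.not_gt

/-- `x` and `y` have the same coordinates above `s`. -/
def AgreeAbove {S : Set ℝ} (s : ℝ) (x y : US S) : Prop :=
  ∀ t : S, s < t → x.1 t = y.1 t

namespace AgreeAbove

variable {S : Set ℝ} {s t : ℝ} {x y z : US S}

theorem refl (s : ℝ) (x : US S) : AgreeAbove s x x := fun _ _ => rfl

theorem symm (h : AgreeAbove s x y) : AgreeAbove s y x := fun t ht => (h t ht).symm

theorem trans (h : AgreeAbove s x y) (h' : AgreeAbove s y z) : AgreeAbove s x z :=
  fun t ht => (h t ht).trans (h' t ht)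

theorem mono (h : AgreeAbove s x y) (hst : s ≤ t) : AgreeAbove t x y :=
  fun u hu => h u (hst.trans_lt hu)

end AgreeAbove

theorem US.finite_diff {S : Set ℝ} (x y : US S) {ε : ℝ} (hε : 0 < ε) :
    {t : S | ε ≤ t ∧ x.1 t ≠ y.1 t}.Finite := by
  refine ((x.2.finite hε).union (y.2.finite hε)).subset ?_
  rintro t ⟨ht, hne⟩
  by_cases hx : x.1 t = 0
  · exact Or.inr ⟨ht, fun hy => hne (hx.trans hy.symm)⟩
  · exact Or.inl ⟨ht, hx⟩

theorem US.exists_max_diff {S : Set ℝ} (hSpos : ∀ s ∈ S, 0 < s) {x y : US S} {s : ℝ} {v : S}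
    (hv : s < v) (hne : x.1 v ≠ y.1 v) :
    ∃ t : S, s < t ∧ x.1 t ≠ y.1 t ∧ AgreeAbove t x y := by
  obtain ⟨t, ⟨hvt, ht⟩, hmax⟩ := Set.exists_max_image _ (Subtype.val : S → ℝ)
    (US.finite_diff x y (hSpos _ v.2)) ⟨v, le_rfl, hne⟩
  refine ⟨t, hv.trans_le hvt, ht, fun u hu => ?_⟩
  by_contra hcon
  exact absurd (hmax u ⟨hvt.trans hu.le, hcon⟩) (not_le.2 hu)

theorem US.exists_max_diff_of_ne {S : Set ℝ} (hSpos : ∀ s ∈ S, 0 < s) {x y : US S}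
    (hxy : x ≠ y) : ∃ t : S, x.1 t ≠ y.1 t ∧ AgreeAbove t x y := by
  obtain ⟨v, hv⟩ := Function.ne_iff.1 fun h => hxy (Subtype.ext h)
  obtain ⟨t, -, ht⟩ := US.exists_max_diff hSpos (hSpos _ v.2) hv
  exact ⟨t, ht⟩

theorem dU_self {S : Set ℝ} (x : US S) : dU S x x = 0 := by simp [dU]

theorem dU_comm {S : Set ℝ} (x y : US S) : dU S x y = dU S y x := by
  simp only [dU, eq_comm]

theorem dU_eq_of_max_diff {S : Set ℝ} {x y : US S} {t : S} (ht : x.1 t ≠ y.1 t)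
    (h : AgreeAbove t x y) : dU S x y = t := by
  have hxy : x ≠ y := fun h => ht (by rw [h])
  rw [dU, if_neg hxy]
  refine IsLeast.csInf_eq ⟨⟨t.2, h⟩, fun r hr => ?_⟩
  by_contra hlt
  exact ht (hr.2 t (not_le.1 hlt))

theorem dU_le_iff {S : Set ℝ} (hSpos : ∀ s ∈ S, 0 < s) {x y : US S} {s : ℝ} (hs : 0 ≤ s) :
    dU S x y ≤ s ↔ AgreeAbove s x y := by
  by_cases hxy : x = y
  · subst hxy
    simp [dU_self, hs, AgreeAbove.refl]
  · obtain ⟨t, ht, h⟩ := US.exists_max_diff_of_ne hSpos hxy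
    rw [dU_eq_of_max_diff ht h]
    exact ⟨fun hts => h.mono hts, fun h' => not_lt.1 fun hst => ht (h' t hst)⟩

theorem dU_nonneg {S : Set ℝ} (hSpos : ∀ s ∈ S, 0 < s) (x y : US S) : 0 ≤ dU S x y := by
  by_cases hxy : x = y
  · rw [hxy, dU_self]
  · obtain ⟨t, ht, h⟩ := US.exists_max_diff_of_ne hSpos hxy
    rw [dU_eq_of_max_diff ht h]
    exact (hSpos _ t.2).le

theorem agreeAbove_dU {S : Set ℝ} (hSpos : ∀ s ∈ S, 0 < s) (x y : US S) :
    AgreeAbove (dU S x y) x y :=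
  (dU_le_iff hSpos (dU_nonneg hSpos x y)).1 le_rfl

theorem dU_ultra {S : Set ℝ} (hSpos : ∀ s ∈ S, 0 < s) (x y z : US S) :
    dU S x z ≤ max (dU S x y) (dU S y z) :=
  (dU_le_iff hSpos (le_max_of_le_left (dU_nonneg hSpos x y))).2
    (((agreeAbove_dU hSpos x y).mono (le_max_left _ _)).trans
      ((agreeAbove_dU hSpos y z).mono (le_max_right _ _)))

theorem dU_pos {S : Set ℝ} (hSpos : ∀ s ∈ S, 0 < s) {x y : US S} (hxy : x ≠ y) :
    0 < dU S x y := by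
  obtain ⟨t, ht, h⟩ := US.exists_max_diff_of_ne hSpos hxy
  rw [dU_eq_of_max_diff ht h]
  exact hSpos _ t.2

theorem exists_dU_eq {S : Set ℝ} (hSpos : ∀ s ∈ S, 0 < s) {x y : US S} (hxy : x ≠ y) :
    ∃ t : S, dU S x y = t ∧ x.1 t ≠ y.1 t ∧ AgreeAbove t x y := by
  obtain ⟨t, ht, h⟩ := US.exists_max_diff_of_ne hSpos hxy
  exact ⟨t, dU_eq_of_max_diff ht h, ht, h⟩

/-- A bijection of `U_S` which preserves agreement above every level is an isometry. -/
theorem dU_equiv_apply {S : Set ℝ} (hSpos : ∀ s ∈ S, 0 < s) (e : US S ≃ US S)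
    (h : ∀ s x y, AgreeAbove s x y → AgreeAbove s (e x) (e y))
    (h' : ∀ s x y, AgreeAbove s x y → AgreeAbove s (e.symm x) (e.symm y)) (x y : US S) :
    dU S (e x) (e y) = dU S x y := by
  apply le_antisymm
  · exact (dU_le_iff hSpos (dU_nonneg hSpos _ _)).2 (h _ _ _ (agreeAbove_dU hSpos x y))
  · refine (dU_le_iff hSpos (dU_nonneg hSpos _ _)).2 ?_
    simpa using h' _ _ _ (agreeAbove_dU hSpos (e x) (e y))

namespace IsoU

variable {S : Set ℝ}

theorem mul_apply (g h : IsoU S) (x : US S) : (g * h).1 x = g.1 (h.1 x) := rfl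

theorem inv_val (g : IsoU S) : (g⁻¹).1 = g.1.symm := rfl

theorem ext {g h : IsoU S} (H : ∀ x, g.1 x = h.1 x) : g = h := Subtype.ext (Equiv.ext H)

theorem dU_symm_apply (g : IsoU S) (x y : US S) :
    dU S (g.1.symm x) (g.1.symm y) = dU S x y := (g⁻¹).2 x y

theorem agreeAbove_iff (hSpos : ∀ s ∈ S, 0 < s) (g : IsoU S) {s : ℝ} (hs : 0 ≤ s) {x y : US S} :
    AgreeAbove s (g.1 x) (g.1 y) ↔ AgreeAbove s x y := by
  rw [← dU_le_iff hSpos hs, ← dU_le_iff hSpos hs, g.2]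

end IsoU

/-- The point obtained from `x` by applying `σ` to the coordinate `t`, provided that `x` agrees
with `p` above `t`. -/
noncomputable def moveFun {S : Set ℝ} (hSpos : ∀ s ∈ S, 0 < s)
    (hacc : ∀ ε > 0, ∃ s ∈ S, s < ε) (t : S) (p : US S) (σ : Equiv.Perm ℚ) (x : US S) : US S :=
  ⟨fun u => if u = t ∧ AgreeAbove t x p then σ (x.1 u) else x.1 u, by
    refine USsupp.of_finite hSpos hacc fun ε hε => ?_
    refine ((x.2.finite hε).union (Set.finite_singleton t)).subset ?_
    rintro u ⟨hu, hne⟩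
    by_cases hut : u = t
    · exact Or.inr hut
    · exact Or.inl ⟨hu, by simpa [hut] using hne⟩⟩

section Move

variable {S : Set ℝ} (hSpos : ∀ s ∈ S, 0 < s) (hacc : ∀ ε > 0, ∃ s ∈ S, s < ε)

theorem moveFun_of_ne (t : S) (p : US S) (σ : Equiv.Perm ℚ) (x : US S) {u : S} (hu : u ≠ t) :
    (moveFun hSpos hacc t p σ x).1 u = x.1 u := by
  simp [moveFun, hu]

theorem moveFun_of_agreeAbove {t : S} {p : US S} (σ : Equiv.Perm ℚ) {x : US S}
    (h : AgreeAbove t x p) : (moveFun hSpos hacc t p σ x).1 t = σ (x.1 t) := by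
  simp [moveFun, h]

theorem moveFun_of_not_agreeAbove {t : S} {p : US S} (σ : Equiv.Perm ℚ) {x : US S}
    (h : ¬ AgreeAbove t x p) : moveFun hSpos hacc t p σ x = x := by
  apply Subtype.ext
  funext u
  simp [moveFun, h]

theorem moveFun_agreeAbove (t : S) (p : US S) (σ : Equiv.Perm ℚ) (x : US S) :
    AgreeAbove t (moveFun hSpos hacc t p σ x) x :=
  fun _ hu => moveFun_of_ne _ _ _ _ _ _ fun h => hu.ne (congrArg _ h.symm)

theorem agreeAbove_moveFun_left {t : S} {p : US S} {σ : Equiv.Perm ℚ} {x y : US S} {s : ℝ}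
    (hs : t ≤ s) : AgreeAbove s (moveFun hSpos hacc t p σ x) y ↔ AgreeAbove s x y :=
  ⟨fun h => ((moveFun_agreeAbove hSpos hacc t p σ x).mono hs).symm.trans h,
    fun h => ((moveFun_agreeAbove hSpos hacc t p σ x).mono hs).trans h⟩

theorem moveFun_mul (t : S) (p : US S) (σ τ : Equiv.Perm ℚ) (x : US S) :
    moveFun hSpos hacc t p (σ * τ) x = moveFun hSpos hacc t p σ (moveFun hSpos hacc t p τ x) := by
  apply Subtype.ext
  funext u
  by_cases hx : AgreeAbove t x p
  · by_cases hu : u = t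
    · subst hu
      rw [moveFun_of_agreeAbove _ _ _ hx, moveFun_of_agreeAbove, moveFun_of_agreeAbove _ _ _ hx]
      · rfl
      · exact (agreeAbove_moveFun_left hSpos hacc le_rfl).2 hx
    · simp only [moveFun_of_ne _ _ _ _ _ _ hu]
  · simp only [moveFun_of_not_agreeAbove _ _ _ hx]

theorem moveFun_one (t : S) (p : US S) (x : US S) : moveFun hSpos hacc t p 1 x = x := by
  apply Subtype.ext
  funext u
  simp [moveFun]

theorem AgreeAbove.moveFun (t : S) (p : US S) (σ : Equiv.Perm ℚ) {s : ℝ} {x y : US S}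
    (h : AgreeAbove s x y) :
    AgreeAbove s (moveFun hSpos hacc t p σ x) (moveFun hSpos hacc t p σ y) := by
  intro u hu
  by_cases hut : u = t
  · subst hut
    have h1 : AgreeAbove u x p ↔ AgreeAbove u y p :=
      ⟨fun h' => (h.mono hu.le).symm.trans h', fun h' => (h.mono hu.le).trans h'⟩
    by_cases hx : AgreeAbove u x p
    · rw [moveFun_of_agreeAbove _ _ _ hx, moveFun_of_agreeAbove _ _ _ (h1.1 hx), h u hu]
    · rw [moveFun_of_not_agreeAbove _ _ _ hx, moveFun_of_not_agreeAbove _ _ _ (mt h1.2 hx), h u hu]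
  · rw [moveFun_of_ne _ _ _ _ _ _ hut, moveFun_of_ne _ _ _ _ _ _ hut, h u hu]

/-- The isometry of `U_S` applying `σ` to the coordinate `t` of the points which agree with `p`
above `t`. -/
noncomputable def move (t : S) (p : US S) (σ : Equiv.Perm ℚ) : IsoU S :=
  let e : US S ≃ US S :=
    { toFun := moveFun hSpos hacc t p σ
      invFun := moveFun hSpos hacc t p σ⁻¹
      left_inv := fun x => by rw [← moveFun_mul, inv_mul_cancel, moveFun_one]
      right_inv := fun x => by rw [← moveFun_mul, mul_inv_cancel, moveFun_one] }
  ⟨e, dU_equiv_apply hSpos e (fun _ _ _ h => h.moveFun hSpos hacc t p σ)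
    (fun _ _ _ h => h.moveFun hSpos hacc t p σ⁻¹)⟩

theorem move_apply (t : S) (p : US S) (σ : Equiv.Perm ℚ) (x : US S) :
    (move hSpos hacc t p σ).1 x = moveFun hSpos hacc t p σ x := rfl

theorem move_mul (t : S) (p : US S) (σ τ : Equiv.Perm ℚ) :
    move hSpos hacc t p (σ * τ) = move hSpos hacc t p σ * move hSpos hacc t p τ :=
  IsoU.ext fun x => moveFun_mul hSpos hacc t p σ τ x

theorem move_congr {t : S} {p q : US S} (h : AgreeAbove t p q) (σ : Equiv.Perm ℚ) :
    move hSpos hacc t p σ = move hSpos hacc t q σ := by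
  refine IsoU.ext fun x => ?_
  have : AgreeAbove t x p ↔ AgreeAbove t x q := ⟨fun h' => h'.trans h, fun h' => h'.trans h.symm⟩
  apply Subtype.ext
  funext u
  simp only [move_apply, moveFun, this]

/-- Moves at different nodes of the same level commute. -/
theorem move_commute {t : S} {p q : US S} (h : ¬ AgreeAbove t p q) (σ τ : Equiv.Perm ℚ) :
    move hSpos hacc t p σ * move hSpos hacc t q τ =
      move hSpos hacc t q τ * move hSpos hacc t p σ := by
  refine IsoU.ext fun x => ?_
  simp only [IsoU.mul_apply, move_apply]
  by_cases hp : AgreeAbove t x p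
  · have hq : ¬ AgreeAbove t x q := fun hq => h (hp.symm.trans hq)
    rw [moveFun_of_not_agreeAbove _ _ τ hq, moveFun_of_not_agreeAbove _ _ τ]
    exact fun h' => hq ((agreeAbove_moveFun_left hSpos hacc le_rfl).1 h')
  · rw [moveFun_of_not_agreeAbove _ _ σ hp, moveFun_of_not_agreeAbove _ _ σ]
    exact fun h' => hp ((agreeAbove_moveFun_left hSpos hacc le_rfl).1 h')

/-- Moves at a higher level permute the moves at a lower level by conjugation. -/
theorem move_mul_move_of_lt {t u : S} (htu : t < u) (p q : US S) (σ τ : Equiv.Perm ℚ) :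
    move hSpos hacc u q τ * move hSpos hacc t p σ =
      move hSpos hacc t ((move hSpos hacc u q τ).1 p) σ * move hSpos hacc u q τ := by
  refine IsoU.ext fun x => Subtype.ext (funext fun v => ?_)
  have hiff : AgreeAbove t (moveFun hSpos hacc u q τ x) (moveFun hSpos hacc u q τ p) ↔
      AgreeAbove t x p :=
    IsoU.agreeAbove_iff hSpos (move hSpos hacc u q τ) (hSpos _ t.2).le
  have hiff' : AgreeAbove u (moveFun hSpos hacc t p σ x) q ↔ AgreeAbove u x q :=
    agreeAbove_moveFun_left hSpos hacc (le_of_lt (Subtype.coe_lt_coe.2 htu))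
  simp only [IsoU.mul_apply, move_apply]
  simp only [moveFun] at hiff hiff' ⊢
  simp only [hiff, hiff']
  by_cases hv : v = t
  · subst hv
    simp [htu.ne]
  · simp [hv]

end Move

theorem dU_eq_iff_of_agreeAbove {S : Set ℝ} (hSpos : ∀ s ∈ S, 0 < s)
    {x y : US S} {t : S} (h : AgreeAbove t x y) :
    dU S x y = t ↔ x.1 t ≠ y.1 t := by
  refine ⟨fun hd => ?_, fun hne => dU_eq_of_max_diff hne h⟩
  have hxy : x ≠ y := by
    rintro rfl
    rw [dU_self] at hd
    exact (hSpos _ t.2).ne hd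
  obtain ⟨u, hu, hne, -⟩ := exists_dU_eq hSpos hxy
  have : u = t := Subtype.ext (hu.symm.trans hd)
  rwa [this] at hne

theorem agreeAbove_of_dU_eq {S : Set ℝ} (hSpos : ∀ s ∈ S, 0 < s)
    {x y : US S} {t : S} (h : dU S x y = t) : AgreeAbove t x y :=
  h ▸ agreeAbove_dU hSpos x y

section Homogeneity

variable {S : Set ℝ} (hSpos : ∀ s ∈ S, 0 < s) (hacc : ∀ ε > 0, ∃ s ∈ S, s < ε)

/-- The group generated by the moves along permutations of `ℚ` preserving the relation `o`. -/
noncomputable def moveGroup (o : ℚ → ℚ → Prop) : Subgroup (IsoU S) :=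
  Subgroup.closure {g | ∃ (t : S) (p : US S) (σ : Equiv.Perm ℚ),
    (∀ a b, o (σ a) (σ b) ↔ o a b) ∧ g = move hSpos hacc t p σ}

theorem move_mem_moveGroup {o : ℚ → ℚ → Prop} (t : S) (p : US S) {σ : Equiv.Perm ℚ}
    (hσ : ∀ a b, o (σ a) (σ b) ↔ o a b) :
    move hSpos hacc t p σ ∈ moveGroup hSpos hacc o :=
  Subgroup.subset_closure ⟨t, p, σ, hσ, rfl⟩

theorem moveGroup_preserves {o : ℚ → ℚ → Prop} {k : IsoU S} (hk : k ∈ moveGroup hSpos hacc o) :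
    ∀ (x y : US S) (t : S), AgreeAbove t x y →
      (o ((k.1 x).1 t) ((k.1 y).1 t) ↔ o (x.1 t) (y.1 t)) := by
  induction hk using Subgroup.closure_induction with
  | mem g hg =>
    obtain ⟨u, p, σ, hσ, rfl⟩ := hg
    intro x y t hxy
    simp only [move_apply]
    by_cases htu : t = u
    · subst htu
      by_cases hx : AgreeAbove t x p
      · rw [moveFun_of_agreeAbove _ _ _ hx, moveFun_of_agreeAbove _ _ _ (hxy.symm.trans hx), hσ]
      · rw [moveFun_of_not_agreeAbove _ _ _ hx,
          moveFun_of_not_agreeAbove _ _ _ fun hy => hx (hxy.trans hy)]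
    · rw [moveFun_of_ne _ _ _ _ _ _ htu, moveFun_of_ne _ _ _ _ _ _ htu]
  | one => exact fun x y t _ => Iff.rfl
  | mul g h _ _ hg hh =>
    intro x y t hxy
    rw [IsoU.mul_apply, IsoU.mul_apply, hg, hh _ _ _ hxy]
    exact (IsoU.agreeAbove_iff hSpos h (hSpos _ t.2).le).2 hxy
  | inv g _ hg =>
    intro x y t hxy
    rw [← hg _ _ t ((IsoU.agreeAbove_iff hSpos g⁻¹ (hSpos _ t.2).le).2 hxy)]
    simp only [IsoU.inv_val, Equiv.apply_symm_apply]

/-- Homogeneity: if finite partial `o`-automorphisms of `ℚ` have one-point extensions, then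
finite partial isometries of `U_S` which respect `o` levelwise agree, up to `s`, with elements
of `moveGroup o`. -/
theorem exists_mem_moveGroup_agreeAbove (o : ℚ → ℚ → Prop)
    (ho : ∀ (Q : Finset ℚ) (u v : ℚ), u ∉ Q → v ∉ Q →
      (∀ q ∈ Q, (o q u ↔ o q v) ∧ (o u q ↔ o v q)) →
      ∃ σ : Equiv.Perm ℚ, (∀ a b, o (σ a) (σ b) ↔ o a b) ∧ σ u = v ∧ ∀ q ∈ Q, σ q = q)
    {s : ℝ} (hs : 0 < s) {ι : Type*} (A : Finset ι) (φ ψ : ι → US S)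
    (hiso : ∀ a ∈ A, ∀ b ∈ A, dU S (φ a) (φ b) = dU S (ψ a) (ψ b))
    (hord : ∀ a ∈ A, ∀ b ∈ A, ∀ t : S, dU S (φ a) (φ b) = t →
      (o ((φ a).1 t) ((φ b).1 t) ↔ o ((ψ a).1 t) ((ψ b).1 t))) :
    ∃ k ∈ moveGroup hSpos hacc o, ∀ a ∈ A, AgreeAbove s (k.1 (φ a)) (ψ a) := by
  induction A using Finset.induction_on with
  | empty => exact ⟨1, one_mem _, by simp⟩
  | insert b A _ ih =>
    obtain ⟨k₀, hk₀, hk₀A⟩ := ih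
      (fun a ha c hc => hiso a (Finset.mem_insert_of_mem ha) c (Finset.mem_insert_of_mem hc))
      (fun a ha c hc => hord a (Finset.mem_insert_of_mem ha) c (Finset.mem_insert_of_mem hc))
    suffices H : ∀ n : ℕ, ∀ k ∈ moveGroup hSpos hacc o,
        (∀ a ∈ A, AgreeAbove s (k.1 (φ a)) (ψ a)) →
        {w : S | s ≤ w ∧ (k.1 (φ b)).1 w ≠ (ψ b).1 w}.ncard = n →
        ∃ k' ∈ moveGroup hSpos hacc o, (∀ a ∈ A, AgreeAbove s (k'.1 (φ a)) (ψ a)) ∧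
          AgreeAbove s (k'.1 (φ b)) (ψ b) by
      obtain ⟨k, hk, hkA, hkb⟩ := H _ k₀ hk₀ hk₀A rfl
      refine ⟨k, hk, fun a ha => ?_⟩
      rcases Finset.mem_insert.1 ha with rfl | ha
      exacts [hkb, hkA a ha]
    intro n
    induction n using Nat.strong_induction_on with
    | _ n ihn =>
    intro k hk hkA hn
    by_cases hb : AgreeAbove s (k.1 (φ b)) (ψ b)
    · exact ⟨k, hk, hkA, hb⟩
    have : ∃ v : S, s < v ∧ (k.1 (φ b)).1 v ≠ (ψ b).1 v := by
      simpa [AgreeAbove] using hb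
    obtain ⟨v, hv, hvne⟩ := this
    obtain ⟨t, hst, htne, htag⟩ := US.exists_max_diff hSpos hv hvne
    have hbm := Finset.mem_insert_self b A
    have hA : ∀ a ∈ A, AgreeAbove t (ψ a) (ψ b) →
        (k.1 (φ a)).1 t = (ψ a).1 t ∧ AgreeAbove t (k.1 (φ a)) (k.1 (φ b)) := fun a ha hag =>
      ⟨hkA a ha t hst, ((hkA a ha).mono hst.le).trans (hag.trans htag.symm)⟩
    have hne : ∀ a ∈ A, AgreeAbove t (ψ a) (ψ b) →
        (ψ a).1 t ≠ (k.1 (φ b)).1 t ∧ (ψ a).1 t ≠ (ψ b).1 t := by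
      intro a ha hag
      obtain ⟨h1, h2⟩ := hA a ha hag
      have h3 := dU_eq_iff_of_agreeAbove hSpos h2
      rw [k.2, hiso a (Finset.mem_insert_of_mem ha) b hbm, dU_eq_iff_of_agreeAbove hSpos hag,
        h1] at h3
      constructor
      · intro h
        exact h3.1 (fun h' => htne (h.symm.trans h')) h
      · intro h
        exact h3.2 (fun h' => htne (h'.symm.trans h)) h
    let Q : Finset ℚ := {a ∈ A | AgreeAbove t (ψ a) (ψ b)}.image fun a => (ψ a).1 t
    have hQ : ∀ q ∈ Q, ∃ a ∈ A, AgreeAbove t (ψ a) (ψ b) ∧ (ψ a).1 t = q := by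
      intro q hq
      obtain ⟨a, ha, rfl⟩ := Finset.mem_image.1 hq
      exact ⟨a, (Finset.mem_filter.1 ha).1, (Finset.mem_filter.1 ha).2, rfl⟩
    obtain ⟨σ, hσo, hσu, hσQ⟩ := ho Q ((k.1 (φ b)).1 t) ((ψ b).1 t)
      (fun hq => by
        obtain ⟨a, ha, hag, h⟩ := hQ _ hq
        exact (hne a ha hag).1 h)
      (fun hq => by
        obtain ⟨a, ha, hag, h⟩ := hQ _ hq
        exact (hne a ha hag).2 h)
      (fun q hq => by
        obtain ⟨a, ha, hag, rfl⟩ := hQ _ hq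
        obtain ⟨h1, h2⟩ := hA a ha hag
        have hφ : AgreeAbove t (φ a) (φ b) :=
          (IsoU.agreeAbove_iff hSpos k (hSpos _ t.2).le).1 h2
        have hamem := Finset.mem_insert_of_mem (a := a) (b := b) ha
        have hd : dU S (φ a) (φ b) = t := by
          rw [hiso a hamem b hbm, dU_eq_iff_of_agreeAbove hSpos hag]
          exact (hne a ha hag).2
        have hd' : dU S (φ b) (φ a) = t := by rw [dU_comm, hd]
        rw [← hord a hamem b hbm t hd, ← hord b hbm a hamem t hd',
          ← moveGroup_preserves hSpos hacc hk _ _ _ hφ,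
          ← moveGroup_preserves hSpos hacc hk _ _ _ hφ.symm, h1]
        exact ⟨Iff.rfl, Iff.rfl⟩)
    let k' := move hSpos hacc t (ψ b) σ * k
    have hk'b : (k'.1 (φ b)).1 t = (ψ b).1 t := by
      rw [IsoU.mul_apply, move_apply, moveFun_of_agreeAbove _ _ _ htag, hσu]
    have hk'ne : ∀ x, ∀ w : S, w ≠ t → (k'.1 x).1 w = (k.1 x).1 w := fun x w hw => by
      rw [IsoU.mul_apply, move_apply, moveFun_of_ne _ _ _ _ _ _ hw]
    refine ihn _ ?_ k' (mul_mem (move_mem_moveGroup hSpos hacc t (ψ b) hσo) hk) ?_ rfl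
    · rw [← hn]
      refine Set.ncard_lt_ncard ⟨?_, ?_⟩ (US.finite_diff _ _ hs)
      · rintro w ⟨hw, hwne⟩
        refine ⟨hw, ?_⟩
        by_cases hwt : w = t
        · exact absurd (hwt ▸ hk'b) hwne
        · rwa [hk'ne _ _ hwt] at hwne
      · intro hsub
        exact (hsub (show t ∈ _ from ⟨hst.le, htne⟩)).2 hk'b
    · intro a ha w hw
      by_cases hwt : w = t
      · subst hwt
        rw [IsoU.mul_apply, move_apply]
        by_cases hag : AgreeAbove w (k.1 (φ a)) (ψ b)
        · have hag' : AgreeAbove w (ψ a) (ψ b) := ((hkA a ha).mono hst.le).symm.trans hag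
          rw [moveFun_of_agreeAbove _ _ _ hag, (hA a ha hag').1]
          exact hσQ _ (Finset.mem_image_of_mem _ (Finset.mem_filter.2 ⟨ha, hag'⟩))
        · rw [moveFun_of_not_agreeAbove _ _ _ hag, hkA a ha w hw]
      · rw [hk'ne _ _ hwt, hkA a ha w hw]

end Homogeneity

section Orders

variable {S : Set ℝ}

/-- In an isosceles configuration with short base, the two long sides are equal. -/
theorem dU_eq_of_lt (hSpos : ∀ s ∈ S, 0 < s) (x : US S) {y z : US S} (h : dU S y z < dU S x y) :
    dU S x z = dU S x y := by
  apply le_antisymm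
  · exact (dU_ultra hSpos x y z).trans (max_le le_rfl h.le)
  · have := dU_ultra hSpos x z y
    rw [dU_comm z y] at this
    rcases le_max_iff.1 this with h' | h'
    · exact h'
    · exact absurd h (not_lt.2 h')

theorem IsConvexSTO.congr_right {r : US S → US S → Prop} (hr : IsConvexSTO (dU S) r)
    {x y z : US S} (h : r x y) (hd : dU S y z < dU S x y) : r x z := by
  rcases hr.1.2.2 x z with h' | rfl | h'
  · exact h'
  · rw [dU_comm] at hd
    exact absurd hd (lt_irrefl _)
  · have := (hr.2 _ _ _ h' h).2
    rw [dU_comm z y] at this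
    exact absurd hd (not_lt.2 this)

theorem IsConvexSTO.congr_left {r : US S → US S → Prop} (hr : IsConvexSTO (dU S) r)
    {x y z : US S} (h : r x y) (hd : dU S x z < dU S x y) : r z y := by
  rcases hr.1.2.2 z y with h' | rfl | h'
  · exact h'
  · exact absurd hd (lt_irrefl _)
  · have := (hr.2 _ _ _ h h').1
    exact absurd hd (not_lt.2 this)

theorem IsConvexSTO.congr (hSpos : ∀ s ∈ S, 0 < s) {r : US S → US S → Prop}
    (hr : IsConvexSTO (dU S) r) {x y x' y' : US S} (hx : dU S x x' < dU S x y)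
    (hy : dU S y y' < dU S x y) :
    r x y ↔ r x' y' := by
  have e1 : dU S x y' = dU S x y := dU_eq_of_lt hSpos x hy
  have e2 : dU S x' y' = dU S x y := by
    rw [dU_comm, dU_eq_of_lt hSpos y', dU_comm, e1]
    rwa [dU_comm y', e1]
  constructor
  · intro h
    exact hr.congr_left (hr.congr_right h hy) (by rwa [e1])
  · intro h
    refine hr.congr_right (hr.congr_left h (z := x) (by rwa [e2, dU_comm])) ?_
    rwa [dU_comm, e1]

theorem IsConvexSTO.asymm {r : US S → US S → Prop} (hr : IsConvexSTO (dU S) r)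
    {x y : US S} (h : r x y) : ¬ r y x := fun h' => hr.1.1 _ (hr.1.2.1 _ _ _ h h')

/-- The lexicographic order of `U_S`. -/
def lexLT (x y : US S) : Prop := ∃ t : S, x.1 t < y.1 t ∧ AgreeAbove t x y

theorem lexLT_iff_of_dU_eq (hSpos : ∀ s ∈ S, 0 < s) {x y : US S} {t : S} (h : dU S x y = t) :
    lexLT x y ↔ x.1 t < y.1 t := by
  refine ⟨?_, fun hlt => ⟨t, hlt, agreeAbove_of_dU_eq hSpos h⟩⟩
  rintro ⟨u, hu, hag⟩
  have : u = t := Subtype.ext ((dU_eq_of_max_diff hu.ne hag).symm.trans h)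
  rwa [← this]

theorem isConvexSTO_lexLT (hSpos : ∀ s ∈ S, 0 < s) : IsConvexSTO (dU S) (lexLT (S := S)) := by
  have htrans : ∀ x y z : US S, lexLT x y → lexLT y z →
      lexLT x z ∧ dU S x y ≤ dU S x z ∧ dU S y z ≤ dU S x z := by
    rintro x y z ⟨t, ht, hxy⟩ ⟨u, hu, hyz⟩
    rw [dU_eq_of_max_diff ht.ne hxy, dU_eq_of_max_diff hu.ne hyz]
    rcases lt_trichotomy t u with h | h | h
    · have h1 := hxy.mono (le_of_lt (Subtype.coe_lt_coe.2 h))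
      have h2 : x.1 u < z.1 u := by rwa [hxy u h]
      rw [dU_eq_of_max_diff h2.ne (h1.trans hyz)]
      exact ⟨⟨u, h2, h1.trans hyz⟩, le_of_lt (Subtype.coe_lt_coe.2 h), le_rfl⟩
    · subst h
      rw [dU_eq_of_max_diff (ht.trans hu).ne (hxy.trans hyz)]
      exact ⟨⟨t, ht.trans hu, hxy.trans hyz⟩, le_rfl, le_rfl⟩
    · have h1 := hyz.mono (le_of_lt (Subtype.coe_lt_coe.2 h))
      have h2 : x.1 t < z.1 t := by rwa [← hyz t h]
      rw [dU_eq_of_max_diff h2.ne (hxy.trans h1)]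
      exact ⟨⟨t, h2, hxy.trans h1⟩, le_rfl, le_of_lt (Subtype.coe_lt_coe.2 h)⟩
  refine ⟨⟨?_, fun x y z h h' => (htrans x y z h h').1, fun x y => ?_⟩,
    fun x y z h h' => (htrans x y z h h').2⟩
  · rintro x ⟨t, ht, -⟩
    exact lt_irrefl _ ht
  · by_cases hxy : x = y
    · exact Or.inr (Or.inl hxy)
    · obtain ⟨t, ht, hag⟩ := US.exists_max_diff_of_ne hSpos hxy
      rcases lt_or_gt_of_ne ht with h | h
      · exact Or.inl ⟨t, h, hag⟩
      · exact Or.inr (Or.inr ⟨t, h, hag.symm⟩)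

/-- The lexicographic order as a point of `cLO(U_S)`. -/
noncomputable def lexOrder (hSpos : ∀ s ∈ S, 0 < s) : cLOU S :=
  ⟨fun x y => decide (lexLT x y), by simpa using isConvexSTO_lexLT hSpos⟩

theorem lexOrder_apply (hSpos : ∀ s ∈ S, 0 < s) (x y : US S) :
    (lexOrder hSpos).1 x y = true ↔ lexLT x y := by
  simp [lexOrder]

theorem actU_apply (g : IsoU S) (r : cLOU S) (x y : US S) :
    (actU S g r).1 x y = r.1 (g.1.symm x) (g.1.symm y) := rfl

theorem actU_one (r : cLOU S) : actU S 1 r = r := rfl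

theorem actU_mul (g h : IsoU S) (r : cLOU S) : actU S (g * h) r = actU S g (actU S h r) := rfl

theorem cLOU.apply_eq (hSpos : ∀ s ∈ S, 0 < s) (r : cLOU S) {x y x' y' : US S}
    (hx : dU S x x' < dU S x y) (hy : dU S y y' < dU S x y) : r.1 x y = r.1 x' y' :=
  Bool.eq_iff_iff.2 (r.2.congr hSpos hx hy)

/-- Every finite subset of `U_S` with a convex ordering embeds in `U_S` with the lexicographic
ordering. -/
theorem exists_embedding_lexLT (hSpos : ∀ s ∈ S, 0 < s)
    (hacc : ∀ ε > 0, ∃ s ∈ S, s < ε) (r : cLOU S) (A : Finset (US S)) :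
    ∃ ψ : US S → US S, ∀ a ∈ A, ∀ b ∈ A, dU S (ψ a) (ψ b) = dU S a b ∧
      (r.1 a b = true → lexLT (ψ a) (ψ b)) := by
  have hlex := isConvexSTO_lexLT hSpos
  induction A using Finset.induction_on with
  | empty => exact ⟨id, by simp⟩
  | insert b A hbA ih =>
    obtain ⟨ψ, hψ⟩ := ih
    suffices H : ∃ y, ∀ a ∈ A, dU S (ψ a) y = dU S a b ∧ (r.1 a b = true → lexLT (ψ a) y) ∧
        (r.1 b a = true → lexLT y (ψ a)) by
      obtain ⟨y, hy⟩ := H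
      have hupd : ∀ a ∈ A, Function.update ψ b y a = ψ a := fun a ha => by
        refine Function.update_of_ne ?_ _ _
        rintro rfl
        exact hbA ha
      refine ⟨Function.update ψ b y, fun a ha c hc => ?_⟩
      rcases Finset.mem_insert.1 ha with hab | haA <;> rcases Finset.mem_insert.1 hc with hcb | hcA
      · rw [hab, hcb, dU_self, dU_self]
        exact ⟨rfl, fun h => absurd h (r.2.1.1 _)⟩
      · rw [hab, Function.update_self, hupd c hcA, dU_comm, dU_comm b]
        exact ⟨(hy c hcA).1, (hy c hcA).2.2⟩
      · rw [hcb, Function.update_self, hupd a haA]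
        exact ⟨(hy a haA).1, (hy a haA).2.1⟩
      · rw [hupd a haA, hupd c hcA]
        exact hψ a haA c hcA
    rcases A.eq_empty_or_nonempty with rfl | hne
    · exact ⟨b, by simp⟩
    obtain ⟨a₀, ha₀, hmin⟩ := A.exists_min_image (fun a => dU S a b) hne
    obtain ⟨t, ht, -⟩ := exists_dU_eq hSpos (x := a₀) (y := b) fun h => hbA (h ▸ ha₀)
    let C := {a ∈ A | dU S a b = t}
    have hC : ∀ a ∈ C, AgreeAbove t (ψ a) (ψ a₀) := by
      intro a ha
      obtain ⟨haA, had⟩ := Finset.mem_filter.1 ha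
      rw [← dU_le_iff hSpos (hSpos _ t.2).le, (hψ a haA a₀ ha₀).1]
      refine (dU_ultra hSpos a b a₀).trans (max_le had.le ?_)
      rw [dU_comm, ht]
    obtain ⟨q, hqlo, hqhi⟩ := Order.exists_between_finsets
      ({a ∈ C | r.1 a b = true}.image fun a => (ψ a).1 t)
      ({a ∈ C | r.1 b a = true}.image fun a => (ψ a).1 t) (by
        simp only [Finset.mem_image, Finset.mem_filter]
        rintro _ ⟨a, ⟨haC, hab⟩, rfl⟩ _ ⟨c, ⟨hcC, hbc⟩, rfl⟩
        obtain ⟨haA, had⟩ := Finset.mem_filter.1 haC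
        obtain ⟨hcA, hcd⟩ := Finset.mem_filter.1 hcC
        have h1 : dU S a c = t := by
          apply le_antisymm
          · refine (dU_ultra hSpos a b c).trans (max_le had.le ?_)
            rw [dU_comm, hcd]
          · rw [← had]
            exact (r.2.2 _ _ _ hab hbc).1
        obtain ⟨h2, h3⟩ := hψ a haA c hcA
        exact (lexLT_iff_of_dU_eq hSpos (h2.trans h1)).1 (h3 (r.2.1.2.1 _ _ _ hab hbc)))
    let y := moveFun hSpos hacc t (ψ a₀) (Equiv.swap ((ψ a₀).1 t) q) (ψ a₀)
    have hyt : y.1 t = q := by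
      rw [moveFun_of_agreeAbove _ _ _ (AgreeAbove.refl _ _), Equiv.swap_apply_left]
    have hyag : AgreeAbove t y (ψ a₀) := moveFun_agreeAbove _ _ _ _ _ _
    refine ⟨y, fun a ha => ?_⟩
    rcases (hmin a ha).lt_or_eq with hlt | heq
    · rw [ht] at hlt
      have hba₀ : dU S b a₀ < dU S a b := by rwa [dU_comm, ht]
      have h1 : dU S a a₀ = dU S a b := dU_eq_of_lt hSpos a hba₀
      obtain ⟨h2, h3⟩ := hψ a ha a₀ ha₀
      obtain ⟨-, h4⟩ := hψ a₀ ha₀ a ha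
      have h5 : dU S (ψ a₀) y < dU S (ψ a) (ψ a₀) := by
        rw [h2, h1]
        exact ((dU_le_iff hSpos (hSpos _ t.2).le).2 hyag.symm).trans_lt hlt
      refine ⟨by rw [dU_eq_of_lt hSpos _ h5, h2, h1], fun h => ?_, fun h => ?_⟩
      · exact hlex.congr_right (h3 (r.2.congr_right h hba₀)) h5
      · refine hlex.congr_left (h4 (r.2.congr_left h ?_)) ?_
        · rwa [dU_comm b a]
        · rwa [dU_comm (ψ a₀) (ψ a)]
    · have had : dU S a b = t := heq.symm.trans ht
      have haC : a ∈ C := Finset.mem_filter.2 ⟨ha, had⟩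
      have hag : AgreeAbove t (ψ a) y := (hC a haC).trans hyag.symm
      have hlo : r.1 a b = true → (ψ a).1 t < y.1 t := fun h => by
        rw [hyt]
        exact hqlo _ (Finset.mem_image_of_mem _ (Finset.mem_filter.2 ⟨haC, h⟩))
      have hhi : r.1 b a = true → y.1 t < (ψ a).1 t := fun h => by
        rw [hyt]
        exact hqhi _ (Finset.mem_image_of_mem _ (Finset.mem_filter.2 ⟨haC, h⟩))
      refine ⟨?_, fun h => ⟨t, hlo h, hag⟩, fun h => ⟨t, hhi h, hag.symm⟩⟩
      rw [had, dU_eq_iff_of_agreeAbove hSpos hag]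
      rcases r.2.1.2.2 a b with h | h | h
      · exact (hlo h).ne
      · exact absurd (h ▸ ha) hbA
      · exact (hhi h).ne'

end Orders

section Topology

open Filter Topology

variable {S : Set ℝ}

theorem US.isOpen_ball (x : US S) {ε : ℝ} (hε : 0 < ε) : IsOpen {y | dU S x y < ε} :=
  TopologicalSpace.isOpen_generateFrom_of_mem ⟨x, ε, hε, rfl⟩

theorem US.tendsto_nhds (hSpos : ∀ s ∈ S, 0 < s) {α : Type*} {F : Filter α} {f : α → US S}
    {x : US S} (h : ∀ ε > 0, ∀ᶠ a in F, dU S x (f a) < ε) : Tendsto f F (𝓝 x) := by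
  rw [TopologicalSpace.tendsto_nhds_generateFrom_iff]
  rintro _ ⟨z, ε, hε, rfl⟩ hx
  filter_upwards [h ε hε] with a ha
  exact (dU_ultra hSpos z x _).trans_lt (max_lt hx ha)

theorem IsoU.continuous_symm_apply (x : US S) : Continuous fun g : IsoU S => g.1.symm x :=
  have : Continuous fun g : IsoU S => ((g.1 : US S → US S), (g.1.symm : US S → US S)) :=
    continuous_induced_dom
  (continuous_apply x).comp (continuous_snd.comp this)

theorem cLOU.isInducing_val : IsInducing fun r : cLOU S => r.1 := ⟨rfl⟩

theorem cLOU.continuous_val_apply (x y : US S) : Continuous fun r : cLOU S => r.1 x y :=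
  (continuous_apply y).comp ((continuous_apply x).comp cLOU.isInducing_val.continuous)

/-- The isometries moving finitely many points by at most a positive distance form a
neighbourhood basis of the identity. -/
theorem IsoU.exists_finset_of_mem_nhds_one (hSpos : ∀ s ∈ S, 0 < s) {V : Set (IsoU S)}
    (hV : V ∈ 𝓝 1) :
    ∃ (A : Finset (US S)) (s : ℝ), 0 < s ∧ ∀ g : IsoU S, (∀ a ∈ A, dU S (g.1 a) a ≤ s) → g ∈ V := by
  let F : Filter (IsoU S) :=
    { sets := {V | ∃ (A : Finset (US S)) (s : ℝ), 0 < s ∧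
        ∀ g : IsoU S, (∀ a ∈ A, dU S (g.1 a) a ≤ s) → g ∈ V}
      univ_sets := ⟨∅, 1, one_pos, fun _ _ => trivial⟩
      sets_of_superset := fun ⟨A, s, hs, h⟩ hVW => ⟨A, s, hs, fun g hg => hVW (h g hg)⟩
      inter_sets := fun ⟨A, s, hs, h⟩ ⟨B, t, ht, h'⟩ => ⟨A ∪ B, min s t, lt_min hs ht,
        fun g hg => ⟨h g fun a ha => (hg a (Finset.mem_union_left _ ha)).trans (min_le_left _ _),
          h' g fun a ha => (hg a (Finset.mem_union_right _ ha)).trans (min_le_right _ _)⟩⟩ }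
  suffices H : F ≤ 𝓝 1 from H hV
  rw [nhds_induced, ← Filter.map_le_iff_le_comap]
  refine Tendsto.prodMk_nhds (tendsto_pi_nhds.2 fun x => US.tendsto_nhds hSpos fun ε hε => ?_)
    (tendsto_pi_nhds.2 fun x => US.tendsto_nhds hSpos fun ε hε => ?_)
  · refine ⟨{x}, ε / 2, half_pos hε, fun g hg => ?_⟩
    change dU S x (g.1 x) < ε
    rw [dU_comm]
    exact (hg x (Finset.mem_singleton_self x)).trans_lt (half_lt_self hε)
  · refine ⟨{x}, ε / 2, half_pos hε, fun g hg => ?_⟩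
    change dU S x (g.1.symm x) < ε
    rw [← g.2, Equiv.apply_symm_apply]
    exact (hg x (Finset.mem_singleton_self x)).trans_lt (half_lt_self hε)

theorem cLOU.exists_finset_of_mem_nhds {r : cLOU S} {V : Set (cLOU S)} (hV : V ∈ 𝓝 r) :
    ∃ A : Finset (US S), ∀ r' : cLOU S, (∀ a ∈ A, ∀ b ∈ A, r'.1 a b = r.1 a b) → r' ∈ V := by
  let F : Filter (cLOU S) :=
    { sets := {V | ∃ A : Finset (US S), ∀ r' : cLOU S,
        (∀ a ∈ A, ∀ b ∈ A, r'.1 a b = r.1 a b) → r' ∈ V}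
      univ_sets := ⟨∅, fun _ _ => trivial⟩
      sets_of_superset := fun ⟨A, h⟩ hVW => ⟨A, fun g hg => hVW (h g hg)⟩
      inter_sets := fun ⟨A, h⟩ ⟨B, h'⟩ => ⟨A ∪ B, fun g hg =>
        ⟨h g fun a ha b hb => hg a (Finset.mem_union_left _ ha) b (Finset.mem_union_left _ hb),
          h' g fun a ha b hb =>
            hg a (Finset.mem_union_right _ ha) b (Finset.mem_union_right _ hb)⟩⟩ }
  suffices H : F ≤ 𝓝 r from H hV
  rw [cLOU.isInducing_val.nhds_eq_comap, ← Filter.map_le_iff_le_comap]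
  refine tendsto_pi_nhds.2 fun x => tendsto_pi_nhds.2 fun y => ?_
  rw [nhds_discrete, tendsto_pure]
  refine ⟨{x, y}, fun r' hr' => ?_⟩
  exact hr' x (by simp) y (by simp)

instance : T2Space (cLOU S) := inferInstanceAs (T2Space
    {r : US S → US S → Bool // IsConvexSTO (dU S) (fun x y => r x y = true)})

theorem isClosed_setOf_isConvexSTO {X : Type*} (d : X → X → ℝ) :
    IsClosed {r : X → X → Bool | IsConvexSTO d fun x y => r x y = true} := by
  have hcl : ∀ x y : X, IsClopen {r : X → X → Bool | r x y = true} := fun x y =>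
    (isClopen_discrete {true}).preimage ((continuous_apply y).comp (continuous_apply x))
  simp only [IsConvexSTO, IsSTO, Set.ofPred_and, Set.ofPred_forall]
  refine ((isClosed_iInter fun x => ?_).inter ((isClosed_iInter fun x => isClosed_iInter fun y =>
    isClosed_iInter fun z => ?_).inter
    (isClosed_iInter fun x => isClosed_iInter fun y => ?_))).inter
    (isClosed_iInter fun x => isClosed_iInter fun y => isClosed_iInter fun z => ?_)
  · exact (hcl x x).compl.isClosed
  · exact isClosed_imp (hcl x y).isOpen (isClosed_imp (hcl y z).isOpen (hcl x z).isClosed)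
  · exact (hcl x y).isClosed.union (isClosed_const.union (hcl y x).isClosed)
  · exact isClosed_imp (hcl x y).isOpen (isClosed_imp (hcl y z).isOpen isClosed_const)

instance : CompactSpace (cLOU S) :=
  isCompact_iff_compactSpace.1 (isClosed_setOf_isConvexSTO (dU S)).isCompact

theorem continuous_actU (hSpos : ∀ s ∈ S, 0 < s) :
    Continuous fun p : IsoU S × cLOU S => actU S p.1 p.2 := by
  refine cLOU.isInducing_val.continuous_iff.2
    (continuous_pi fun x => continuous_pi fun y => ?_)
  by_cases hxy : x = y
  · subst hxy
    convert continuous_const (y := false) with p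
    exact Bool.eq_false_iff.2 (p.2.2.1.1 _)
  rw [continuous_iff_continuousAt]
  rintro ⟨g₀, r₀⟩
  rw [ContinuousAt, nhds_discrete Bool, tendsto_pure]
  have hnear : ∀ z, ∀ᶠ g in 𝓝 g₀, dU S (g₀.1.symm z) (g.1.symm z) < dU S x y := fun z =>
    (IsoU.continuous_symm_apply z).continuousAt.eventually_mem
      ((US.isOpen_ball _ (dU_pos hSpos hxy)).mem_nhds (by
        change dU S _ _ < _
        rw [dU_self]
        exact dU_pos hSpos hxy))
  have hr : ∀ᶠ r : cLOU S in 𝓝 r₀, r.1 (g₀.1.symm x) (g₀.1.symm y) =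
      r₀.1 (g₀.1.symm x) (g₀.1.symm y) := by
    have h := (cLOU.continuous_val_apply (g₀.1.symm x) (g₀.1.symm y)).tendsto r₀
    rwa [nhds_discrete Bool, tendsto_pure] at h
  rw [nhds_prod_eq]
  filter_upwards [((hnear x).and (hnear y)).prod_mk hr] with p hp
  obtain ⟨⟨h1, h2⟩, h3⟩ := hp
  have hd : dU S (g₀.1.symm x) (g₀.1.symm y) = dU S x y := by
    rw [← g₀.2]
    simp
  change p.2.1 (p.1.1.symm x) (p.1.1.symm y) = r₀.1 (g₀.1.symm x) (g₀.1.symm y)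
  rw [← h3]
  exact (cLOU.apply_eq hSpos p.2 (by rwa [hd]) (by rwa [hd])).symm

end Topology

section FixedPoint

open Filter Topology

variable {S : Set ℝ} (hSpos : ∀ s ∈ S, 0 < s) (hacc : ∀ ε > 0, ∃ s ∈ S, s < ε)

theorem exists_finset_forall_uniformity {X : Type*} [UniformSpace X] [CompactSpace X]
    (hSpos : ∀ s ∈ S, 0 < s) (a : IsoU S → X → X)
    (hone : ∀ x, a 1 x = x) (hcont : Continuous fun p : IsoU S × X => a p.1 p.2)
    {E : Set (X × X)} (hE : E ∈ uniformity X) :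
    ∃ (A : Finset (US S)) (s : ℝ), 0 < s ∧
      ∀ g : IsoU S, (∀ b ∈ A, dU S (g.1 b) b ≤ s) → ∀ x, (a g x, x) ∈ E := by
  have h : ∀ᶠ g in 𝓝 (1 : IsoU S), ∀ x ∈ (Set.univ : Set X), (a g x, x) ∈ E := by
    refine isCompact_univ.eventually_forall_of_forall_eventually fun x _ => ?_
    have hc : Continuous fun p : IsoU S × X => (a p.1 p.2, p.2) := hcont.prodMk continuous_snd
    exact (hc.tendsto' (1, x) (x, x) (by rw [hone])).eventually (nhds_le_uniformity x hE)
  obtain ⟨A, s, hs, hA⟩ := IsoU.exists_finset_of_mem_nhds_one hSpos h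
  exact ⟨A, s, hs, fun g hg x => hA g hg x trivial⟩

theorem exists_fixed_of_move_invariant {X : Type*} [UniformSpace X] [CompactSpace X] [T2Space X]
    (a : IsoU S → X → X) (hone : ∀ x, a 1 x = x) (hmul : ∀ g h x, a (g * h) x = a g (a h x))
    (hcont : Continuous fun p : IsoU S × X => a p.1 p.2) {Y : Set X} (hY : IsClosed Y)
    (hne : Y.Nonempty) (t : S) (p : US S)
    (hinv : ∀ σ : ℚ ≃o ℚ, ∀ x ∈ Y, a (move hSpos hacc t p σ.toEquiv) x ∈ Y) :
    ∃ x ∈ Y, ∀ σ : ℚ ≃o ℚ, a (move hSpos hacc t p σ.toEquiv) x = x := by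
  refine exists_fixed_of_rat_orderIso_action hY hne
    (fun σ => a (move hSpos hacc t p σ.toEquiv))
    (fun σ => hcont.comp (continuous_const.prodMk continuous_id)) (fun σ τ x => ?_) hinv ?_
  · rw [← hmul, ← move_mul]
    rfl
  · intro E hE
    obtain ⟨A, s, hs, hA⟩ := exists_finset_forall_uniformity hSpos a hone hcont hE
    refine ⟨A.image fun b => b.1 t, fun σ hσ => hA _ fun b hb => ?_⟩
    have : (move hSpos hacc t p σ.toEquiv).1 b = b := by
      refine Subtype.ext (funext fun u => ?_)
      rw [move_apply]
      by_cases hut : u = t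
      · subst hut
        by_cases hbp : AgreeAbove u b p
        · rw [moveFun_of_agreeAbove _ _ _ hbp]
          exact hσ _ (Finset.mem_image_of_mem _ hb)
        · rw [moveFun_of_not_agreeAbove _ _ _ hbp]
      · rw [moveFun_of_ne _ _ _ _ _ _ hut]
    rw [this, dU_self]
    exact hs.le

theorem exists_fixed_of_level_invariant {X : Type*} [UniformSpace X] [CompactSpace X] [T2Space X]
    (a : IsoU S → X → X) (hone : ∀ x, a 1 x = x) (hmul : ∀ g h x, a (g * h) x = a g (a h x))
    (hcont : Continuous fun p : IsoU S × X => a p.1 p.2) {Y : Set X} (hY : IsClosed Y)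
    (hne : Y.Nonempty) (t : S)
    (hinv : ∀ p, ∀ σ : ℚ ≃o ℚ, ∀ x ∈ Y, a (move hSpos hacc t p σ.toEquiv) x ∈ Y) :
    ∃ x ∈ Y, ∀ p, ∀ σ : ℚ ≃o ℚ, a (move hSpos hacc t p σ.toEquiv) x = x := by
  have hc : ∀ g, Continuous (a g) := fun g => hcont.comp (continuous_const.prodMk continuous_id)
  have key : ∀ P : Finset (US S), ∃ x ∈ Y, ∀ p ∈ P, ∀ σ : ℚ ≃o ℚ,
      a (move hSpos hacc t p σ.toEquiv) x = x := by
    intro P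
    induction P using Finset.induction_on with
    | empty =>
      obtain ⟨x, hx⟩ := hne
      exact ⟨x, hx, by simp⟩
    | insert p P _ ih =>
      let Z : Set X := {x | x ∈ Y ∧ ∀ q ∈ P, ∀ σ : ℚ ≃o ℚ,
        a (move hSpos hacc t q σ.toEquiv) x = x}
      have hZ : IsClosed Z := by
        simp only [Z, Set.ofPred_and, Set.ofPred_forall]
        exact hY.inter <| isClosed_iInter fun q => isClosed_iInter fun _ => isClosed_iInter fun σ =>
          isClosed_eq (hc _) continuous_id
      obtain ⟨x, hx, hfix⟩ := exists_fixed_of_move_invariant hSpos hacc a hone hmul hcont hZ ih t p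
        (by
          rintro σ x ⟨hxY, hxP⟩
          refine ⟨hinv p σ x hxY, fun q hq τ => ?_⟩
          by_cases hqp : AgreeAbove t q p
          · rw [← move_congr hSpos hacc hqp, hxP q hq, hxP q hq]
          · rw [← hmul, move_commute hSpos hacc hqp, hmul, hxP q hq])
      refine ⟨x, hx.1, fun q hq => ?_⟩
      rcases Finset.mem_insert.1 hq with rfl | hq
      exacts [hfix, hx.2 q hq]
  obtain ⟨x, hx, hfix⟩ := exists_common_fixed_of_approx hY
    (fun i : US S × (ℚ ≃o ℚ) => a (move hSpos hacc t i.1 i.2.toEquiv)) (fun i => hc _)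
    fun E hE F => by
      obtain ⟨x, hx, hfix⟩ := key (F.image Prod.fst)
      refine ⟨x, hx, fun i hi => ?_⟩
      rw [hfix _ (Finset.mem_image_of_mem _ hi)]
      exact refl_mem_uniformity hE
  exact ⟨x, hx, fun p σ => hfix (p, σ)⟩

/-- In every flow of `iso(U_S)`, every invariant closed nonempty set contains a point fixed by
the moves along order automorphisms of `ℚ`. -/
theorem exists_fixed_moveGroup {X : Type*} [UniformSpace X] [CompactSpace X] [T2Space X]
    (a : IsoU S → X → X) (hone : ∀ x, a 1 x = x) (hmul : ∀ g h x, a (g * h) x = a g (a h x))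
    (hcont : Continuous fun p : IsoU S × X => a p.1 p.2) {Y : Set X} (hY : IsClosed Y)
    (hne : Y.Nonempty) (hinv : ∀ g, ∀ x ∈ Y, a g x ∈ Y) :
    ∃ x ∈ Y, ∀ k ∈ moveGroup hSpos hacc (· < ·), a k x = x := by
  have hc : ∀ g, Continuous (a g) := fun g => hcont.comp (continuous_const.prodMk continuous_id)
  have key : ∀ D : Finset S, ∃ x ∈ Y, ∀ t ∈ D, ∀ p, ∀ σ : ℚ ≃o ℚ,
      a (move hSpos hacc t p σ.toEquiv) x = x := by
    intro D
    induction D using Finset.induction_on_max with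
    | empty =>
      obtain ⟨x, hx⟩ := hne
      exact ⟨x, hx, by simp⟩
    | insert u D hu ih =>
      let Z : Set X := {x | x ∈ Y ∧ ∀ t ∈ D, ∀ p, ∀ σ : ℚ ≃o ℚ,
        a (move hSpos hacc t p σ.toEquiv) x = x}
      have hZ : IsClosed Z := by
        simp only [Z, Set.ofPred_and, Set.ofPred_forall]
        exact hY.inter <| isClosed_iInter fun t => isClosed_iInter fun _ => isClosed_iInter fun p =>
          isClosed_iInter fun σ => isClosed_eq (hc _) continuous_id
      obtain ⟨x, hx, hfix⟩ := exists_fixed_of_level_invariant hSpos hacc a hone hmul hcont hZ ih u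
        (by
          rintro q τ x ⟨hxY, hxD⟩
          refine ⟨hinv _ x hxY, fun t ht p σ => ?_⟩
          have h := move_mul_move_of_lt hSpos hacc (hu t ht)
            ((move hSpos hacc u q τ.toEquiv).1.symm p) q σ.toEquiv τ.toEquiv
          rw [Equiv.apply_symm_apply] at h
          rw [← hmul, ← h, hmul, hxD t ht])
      refine ⟨x, hx.1, fun t ht => ?_⟩
      rcases Finset.mem_insert.1 ht with rfl | ht
      exacts [hfix, hx.2 t ht]
  obtain ⟨x, hx, hfix⟩ := exists_common_fixed_of_approx hY
    (fun i : S × US S × (ℚ ≃o ℚ) => a (move hSpos hacc i.1 i.2.1 i.2.2.toEquiv)) (fun i => hc _)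
    fun E hE F => by
      obtain ⟨x, hx, hfix⟩ := key (F.image Prod.fst)
      refine ⟨x, hx, fun i hi => ?_⟩
      rw [hfix _ (Finset.mem_image_of_mem _ hi)]
      exact refl_mem_uniformity hE
  refine ⟨x, hx, fun k hk => ?_⟩
  induction hk using Subgroup.closure_induction with
  | mem g hg =>
    obtain ⟨t, p, σ, hσ, rfl⟩ := hg
    exact hfix (t, p, ⟨σ, fun {c d} => by
      rw [← not_lt, ← not_lt]
      exact not_congr (hσ d c)⟩)
  | one => exact hone x
  | mul g h _ _ hg hh => rw [hmul, hh, hg]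
  | inv g _ hg => simpa only [← hmul, inv_mul_cancel, hone] using (congrArg (a g⁻¹) hg).symm

end FixedPoint

section Minimality

open Filter Topology

variable {S : Set ℝ} (hSpos : ∀ s ∈ S, 0 < s) (hacc : ∀ ε > 0, ∃ s ∈ S, s < ε)

theorem exists_pos_lt_dU (hSpos : ∀ s ∈ S, 0 < s) (A : Finset (US S)) :
    ∃ s > 0, ∀ a ∈ A, ∀ b ∈ A, a ≠ b → s < dU S a b := by
  have h : ∀ᶠ s in 𝓝[>] (0 : ℝ), ∀ p ∈ A.offDiag, s < dU S p.1 p.2 :=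
    (Filter.eventually_all_finset _).2 fun p hp =>
      nhdsWithin_le_nhds (gt_mem_nhds (dU_pos hSpos (Finset.mem_offDiag.1 hp).2.2))
  obtain ⟨s, hs, hpos⟩ := (h.and self_mem_nhdsWithin).exists
  exact ⟨s, hpos, fun a ha b hb hab => hs (a, b) (Finset.mem_offDiag.2 ⟨ha, hb, hab⟩)⟩

theorem dense_orbit_lexOrder (hSpos : ∀ s ∈ S, 0 < s) (hacc : ∀ ε > 0, ∃ s ∈ S, s < ε) :
    Dense (Set.range fun g => actU S g (lexOrder hSpos)) := by
  intro r
  rw [mem_closure_iff_nhds]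
  intro V hV
  obtain ⟨A, hA⟩ := cLOU.exists_finset_of_mem_nhds hV
  obtain ⟨ψ, hψ⟩ := exists_embedding_lexLT hSpos hacc r A
  obtain ⟨s, hs, hsA⟩ := exists_pos_lt_dU hSpos A
  obtain ⟨k, -, hk⟩ := exists_mem_moveGroup_agreeAbove hSpos hacc (fun _ _ => False)
    (fun Q u v hu hv _ => ⟨Equiv.swap u v, fun _ _ => Iff.rfl, Equiv.swap_apply_left u v,
      fun q hq => Equiv.swap_apply_of_ne_of_ne (fun h => hu (h ▸ hq)) fun h => hv (h ▸ hq)⟩)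
    hs A id ψ (fun a ha b hb => ((hψ a ha b hb).1).symm) fun _ _ _ _ _ _ => Iff.rfl
  refine ⟨_, hA _ fun a ha b hb => ?_, k⁻¹, rfl⟩
  by_cases hab : a = b
  · subst hab
    exact (Bool.eq_false_iff.2 ((actU S k⁻¹ _).2.1.1 a)).trans
      (Bool.eq_false_iff.2 (r.2.1.1 a)).symm
  rw [Bool.eq_iff_iff]
  change (lexOrder hSpos).1 (k.1 a) (k.1 b) = true ↔ _
  have hd : ∀ c ∈ A, dU S (ψ c) (k.1 c) < dU S (ψ a) (ψ b) := fun c hc => by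
    rw [(hψ a ha b hb).1]
    exact ((dU_le_iff hSpos hs.le).2 (hk c hc).symm).trans_lt (hsA a ha b hb hab)
  have hlex := isConvexSTO_lexLT hSpos
  rw [lexOrder_apply, ← hlex.congr hSpos (hd a ha) (hd b hb)]
  refine ⟨fun h => ?_, (hψ a ha b hb).2⟩
  rcases r.2.1.2.2 a b with h' | h' | h'
  · exact h'
  · exact absurd h' hab
  · exact absurd ((hψ b hb a ha).2 h') (hlex.asymm h)

/-- The isometry changing the sign of the coordinates outside of `P`. -/
noncomputable def signFlip (hSpos : ∀ s ∈ S, 0 < s) (P : S → Prop) : IsoU S :=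
  let f : US S → US S := fun x => ⟨fun t => if P t then x.1 t else -x.1 t, by
    obtain ⟨f, hf, hfS, hlim, hx⟩ := x.2
    refine ⟨f, hf, hfS, hlim, fun s hs => hx s fun h => hs ?_⟩
    change (if P s then x.1 s else -x.1 s) = 0
    rw [h, neg_zero, ite_self]⟩
  have hf : Function.Involutive f := fun x => Subtype.ext <| funext fun t => by
    by_cases h : P t <;> simp [f, h]
  have hag : ∀ s x y, AgreeAbove s x y → AgreeAbove s (f x) (f y) := fun s x y h t ht => by
    simp only [f, h t ht]
  ⟨hf.toPerm, dU_equiv_apply hSpos _ hag hag⟩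

theorem signFlip_symm_apply (P : S → Prop) (x : US S) (t : S) :
    ((signFlip hSpos P).1.symm x).1 t = if P t then x.1 t else -x.1 t := rfl

theorem exists_orderIso_rat_perm (Q : Finset ℚ) (u v : ℚ) (_ : u ∉ Q) (_ : v ∉ Q)
    (h : ∀ q ∈ Q, (q < u ↔ q < v) ∧ (u < q ↔ v < q)) :
    ∃ σ : Equiv.Perm ℚ, (∀ a b, σ a < σ b ↔ a < b) ∧ σ u = v ∧ ∀ q ∈ Q, σ q = q := by
  obtain ⟨σ, hσ, hσQ⟩ := exists_orderIso_rat_fixing Q u v (fun q hq => (h q hq).1)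
    fun q hq => (h q hq).2
  exact ⟨σ.toEquiv, fun _ _ => σ.lt_iff_lt, hσ, hσQ⟩

/-- An ordering invariant under the moves along order automorphisms of `ℚ` is, at every level,
either lexicographic or antilexicographic. -/
theorem exists_actU_eq_lexOrder {r : cLOU S}
    (hr : ∀ k ∈ moveGroup hSpos hacc (· < ·), actU S k r = r) :
    ∃ g, actU S g r = lexOrder hSpos := by
  have huniq : ∀ (t : S) (x y x' y' : US S), dU S x y = t → dU S x' y' = t → x.1 t < y.1 t →
      x'.1 t < y'.1 t → r.1 x y = r.1 x' y' := by
    intro t x y x' y' hd hd' hlt hlt'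
    have ht := hSpos _ t.2
    obtain ⟨k, hk, hkA⟩ := exists_mem_moveGroup_agreeAbove hSpos hacc (· < ·)
      exists_orderIso_rat_perm (half_pos ht) (Finset.univ : Finset Bool)
      (fun c => cond c x y) (fun c => cond c x' y')
      (by
        rintro (_ | _) - (_ | _) - <;>
          simp only [cond_true, cond_false, dU_self, hd, hd', dU_comm y, dU_comm y'])
      (by
        rintro (_ | _) - (_ | _) - u hu <;>
          simp only [cond_true, cond_false, dU_self, hd, dU_comm y] at hu ⊢
        · exact absurd hu (hSpos _ u.2).ne
        · obtain rfl := Subtype.ext hu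
          exact iff_of_false hlt.not_gt hlt'.not_gt
        · obtain rfl := Subtype.ext hu
          exact iff_of_true hlt hlt'
        · exact absurd hu (hSpos _ u.2).ne)
    have hnear : ∀ c : Bool, dU S (cond c x' y') (k.1 (cond c x y)) < dU S x' y' := fun c => by
      rw [hd']
      exact ((dU_le_iff hSpos (half_pos ht).le).2 (hkA c (Finset.mem_univ c)).symm).trans_lt
        (half_lt_self ht)
    refine Eq.trans ?_ (r.apply_eq hSpos (x := x') (y := y') (hnear true) (hnear false)).symm
    conv_rhs => rw [← hr k hk]
    simp only [cond_true, cond_false, actU_apply, Equiv.symm_apply_apply]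
  let P : S → Prop := fun t => ∃ x y, dU S x y = t ∧ x.1 t < y.1 t ∧ r.1 x y = true
  have hP : ∀ (t : S) (x y : US S), dU S x y = t → x.1 t < y.1 t → (r.1 x y = true ↔ P t) := by
    refine fun t x y hd hlt => ⟨fun h => ⟨x, y, hd, hlt, h⟩, ?_⟩
    rintro ⟨x', y', hd', hlt', h⟩
    rwa [huniq t x y x' y' hd hd' hlt hlt']
  have hP' : ∀ (t : S) (x y : US S), dU S x y = t → y.1 t < x.1 t →
      (r.1 x y = true ↔ ¬ P t) := by
    intro t x y hd hlt
    rw [← hP t y x (by rw [dU_comm, hd]) hlt]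
    refine ⟨fun h => IsConvexSTO.asymm r.2 h, fun h => ?_⟩
    rcases r.2.1.2.2 x y with h' | rfl | h'
    exacts [h', absurd hlt (lt_irrefl _), absurd h' h]
  refine ⟨signFlip hSpos P, Subtype.ext (funext fun x => funext fun y => ?_)⟩
  by_cases hxy : x = y
  · subst hxy
    exact (Bool.eq_false_iff.2 ((actU S _ r).2.1.1 x)).trans
      (Bool.eq_false_iff.2 ((lexOrder hSpos).2.1.1 x)).symm
  obtain ⟨t, hd, hne, -⟩ := exists_dU_eq hSpos hxy
  rw [Bool.eq_iff_iff, lexOrder_apply, lexLT_iff_of_dU_eq hSpos hd, actU_apply]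
  rw [← IsoU.dU_symm_apply (signFlip hSpos P)] at hd
  by_cases hPt : P t
  · rcases hne.lt_or_gt with h | h
    · rw [hP t _ _ hd (by simpa only [signFlip_symm_apply, if_pos hPt])]
      exact iff_of_true hPt h
    · rw [hP' t _ _ hd (by simpa only [signFlip_symm_apply, if_pos hPt])]
      exact iff_of_false (not_not.2 hPt) h.not_gt
  · rcases hne.lt_or_gt with h | h
    · rw [hP' t _ _ hd (by simpa only [signFlip_symm_apply, if_neg hPt, neg_lt_neg_iff])]
      exact iff_of_true hPt h
    · rw [hP t _ _ hd (by simpa only [signFlip_symm_apply, if_neg hPt, neg_lt_neg_iff])]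
      exact iff_of_false hPt h.not_gt

theorem dense_orbit_cLOU (hSpos : ∀ s ∈ S, 0 < s) (hacc : ∀ ε > 0, ∃ s ∈ S, s < ε)
    (r : cLOU S) : Dense (Set.range fun g => actU S g r) := by
  have hcont := continuous_actU hSpos
  have hinv : ∀ g, ∀ x ∈ closure (Set.range fun g => actU S g r),
      actU S g x ∈ closure (Set.range fun g => actU S g r) := by
    intro g x hx
    refine map_mem_closure (hcont.comp (continuous_const.prodMk continuous_id)) hx ?_
    rintro _ ⟨h, rfl⟩
    exact ⟨g * h, rfl⟩
  let _ : UniformSpace (cLOU S) := uniformSpaceOfCompactR1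
  obtain ⟨x, hx, hfix⟩ := exists_fixed_moveGroup hSpos hacc (actU S) actU_one actU_mul hcont
    isClosed_closure ((Set.range_nonempty _).closure) hinv
  obtain ⟨g, hg⟩ := exists_actU_eq_lexOrder hSpos hacc hfix
  have hlex : lexOrder hSpos ∈ closure (Set.range fun g => actU S g r) := hg ▸ hinv g x hx
  refine dense_closure.1 ((dense_orbit_lexOrder hSpos hacc).mono ?_)
  rintro _ ⟨h, rfl⟩
  exact hinv h _ hlex

end Minimality

section Universality

open Filter Topology

variable {S : Set ℝ}

/-- A closed relation between compact spaces which is the graph of a function is the graph of a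
continuous function. -/
theorem exists_continuous_of_isClosed_graph {X Z : Type*} [TopologicalSpace X] [CompactSpace X]
    [TopologicalSpace Z] [T2Space Z] [CompactSpace Z] {R : Set (Z × X)} (hR : IsClosed R)
    (hex : ∀ z, ∃ x, (z, x) ∈ R)
    (huniq : ∀ z x x', (z, x) ∈ R → (z, x') ∈ R → x = x') :
    ∃ π : Z → X, Continuous π ∧ ∀ z, (z, π z) ∈ R := by
  choose π hπ using hex
  refine ⟨π, continuous_iff_isClosed.2 fun C hC => ?_, hπ⟩
  have : π ⁻¹' C = Prod.fst '' (R ∩ Prod.snd ⁻¹' C) := by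
    ext z
    constructor
    · exact fun hz => ⟨(z, π z), ⟨hπ z, hz⟩, rfl⟩
    · rintro ⟨⟨w, x⟩, ⟨hwx, hx⟩, rfl⟩
      exact Set.mem_preimage.2 (huniq w x (π w) hwx (hπ w) ▸ hx)
  rw [this]
  exact ((hR.inter (hC.preimage continuous_snd)).isCompact.image continuous_fst).isClosed

/-- If two translates of the lexicographic order agree on a finite set, then they differ by an
element of `moveGroup (· < ·)` followed by a small isometry. -/
theorem exists_moveGroup_dU_le (hSpos : ∀ s ∈ S, 0 < s) (hacc : ∀ ε > 0, ∃ s ∈ S, s < ε)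
    (A : Finset (US S)) {s : ℝ} (hs : 0 < s) (g h : IsoU S)
    (hgh : ∀ a ∈ A, ∀ b ∈ A,
      (actU S g (lexOrder hSpos)).1 a b = (actU S h (lexOrder hSpos)).1 a b) :
    ∃ k ∈ moveGroup hSpos hacc (· < ·), ∀ a ∈ A, dU S ((h * k * g⁻¹).1 a) a ≤ s := by
  obtain ⟨k, hk, hkA⟩ := exists_mem_moveGroup_agreeAbove hSpos hacc (· < ·)
    exists_orderIso_rat_perm hs A (fun a => g.1.symm a) (fun a => h.1.symm a)
    (fun a _ b _ => by rw [IsoU.dU_symm_apply, IsoU.dU_symm_apply])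
    (fun a ha b hb t ht => by
      have hlex := Bool.eq_iff_iff.1 (hgh a ha b hb)
      rw [actU_apply, actU_apply, lexOrder_apply, lexOrder_apply,
        lexLT_iff_of_dU_eq hSpos ht] at hlex
      rw [hlex, lexLT_iff_of_dU_eq hSpos]
      rw [← ht, IsoU.dU_symm_apply, IsoU.dU_symm_apply])
  refine ⟨k, hk, fun a ha => ?_⟩
  have h1 := (dU_le_iff hSpos hs.le).2 (hkA a ha)
  rwa [← h.2, Equiv.apply_symm_apply] at h1

theorem exists_equivariant_surjection (hSpos : ∀ s ∈ S, 0 < s) (hacc : ∀ ε > 0, ∃ s ∈ S, s < ε)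
    {X : Type*} [UniformSpace X] [CompactSpace X] [T2Space X] [Nonempty X] (a : IsoU S → X → X)
    (hone : ∀ x, a 1 x = x) (hmul : ∀ g h x, a (g * h) x = a g (a h x))
    (hcont : Continuous fun p : IsoU S × X => a p.1 p.2)
    (hdense : ∀ x : X, Dense (Set.range fun g => a g x)) :
    ∃ π : cLOU S → X, Continuous π ∧ Function.Surjective π ∧
      ∀ (g : IsoU S) (r : cLOU S), π (actU S g r) = a g (π r) := by
  have hc : ∀ g, Continuous (a g) := fun g => hcont.comp (continuous_const.prodMk continuous_id)
  obtain ⟨x₀, -, hx₀⟩ := exists_fixed_moveGroup hSpos hacc a hone hmul hcont isClosed_univ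
    Set.univ_nonempty fun _ _ _ => trivial
  let R : Set (cLOU S × X) :=
    closure (Set.range fun g => (actU S g (lexOrder hSpos), a g x₀))
  have hR : IsClosed R := isClosed_closure
  have hgR : ∀ g, (actU S g (lexOrder hSpos), a g x₀) ∈ R := fun g => subset_closure ⟨g, rfl⟩
  have hRinv : ∀ g, ∀ p ∈ R, (actU S g p.1, a g p.2) ∈ R := by
    intro g p hp
    have hcg : Continuous fun p : cLOU S × X => (actU S g p.1, a g p.2) :=
      ((continuous_actU hSpos).comp (continuous_const.prodMk continuous_fst)).prodMk
        ((hc g).comp continuous_snd)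
    refine map_mem_closure (f := fun p : cLOU S × X => (actU S g p.1, a g p.2)) hcg hp ?_
    rintro _ ⟨h, rfl⟩
    exact ⟨g * h, Prod.ext rfl (hmul _ _ _)⟩
  have hfst : ∀ r, ∃ x, (r, x) ∈ R := by
    have hcl : IsClosed (Prod.fst '' R) := (hR.isCompact.image continuous_fst).isClosed
    have hd : Dense (Prod.fst '' R) := (dense_orbit_lexOrder hSpos hacc).mono (by
      rintro _ ⟨g, rfl⟩
      exact ⟨_, hgR g, rfl⟩)
    intro r
    obtain ⟨⟨r, x⟩, hp, rfl⟩ : r ∈ Prod.fst '' R := hcl.closure_eq ▸ hd r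
    exact ⟨x, hp⟩
  have hsnd : ∀ x, ∃ r, (r, x) ∈ R := by
    have hcl : IsClosed (Prod.snd '' R) := (hR.isCompact.image continuous_snd).isClosed
    have hd : Dense (Prod.snd '' R) := (hdense x₀).mono (by
      rintro _ ⟨g, rfl⟩
      exact ⟨_, hgR g, rfl⟩)
    intro x
    obtain ⟨⟨r, x⟩, hp, rfl⟩ : x ∈ Prod.snd '' R := hcl.closure_eq ▸ hd x
    exact ⟨r, hp⟩
  have huniq : ∀ r x x', (r, x) ∈ R → (r, x') ∈ R → x = x' := by
    intro r x x' hx hx'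
    refine eq_of_forall_symmetric fun {V} hV _ => ?_
    obtain ⟨E, hE, hEsymm, hEV⟩ := comp_comp_symm_mem_uniformity_sets hV
    obtain ⟨A, s, hs, hA⟩ := exists_finset_forall_uniformity hSpos a hone hcont hE
    have hnhds : ∀ᶠ r' in 𝓝 r, ∀ b ∈ A, ∀ c ∈ A, r'.1 b c = r.1 b c := by
      refine (Filter.eventually_all_finset _).2 fun b _ =>
        (Filter.eventually_all_finset _).2 fun c _ => ?_
      have h := (cLOU.continuous_val_apply b c).tendsto r
      rwa [nhds_discrete Bool, tendsto_pure] at h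
    have hnear : ∀ y, (r, y) ∈ R → ∃ g : IsoU S, (∀ b ∈ A, ∀ c ∈ A,
        (actU S g (lexOrder hSpos)).1 b c = r.1 b c) ∧ (y, a g x₀) ∈ E := by
      intro y hy
      obtain ⟨_, ⟨h1, h2⟩, g, rfl⟩ := mem_closure_iff_nhds.1 hy _
        (prod_mem_nhds hnhds (UniformSpace.ball_mem_nhds y hE))
      exact ⟨g, h1, h2⟩
    obtain ⟨g, hg, hxg⟩ := hnear x hx
    obtain ⟨h, hh, hxh⟩ := hnear x' hx'
    obtain ⟨k, hk, hkA⟩ := exists_moveGroup_dU_le hSpos hacc A hs g h fun b hb c hc =>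
      (hg b hb c hc).trans (hh b hb c hc).symm
    have hhg := hA _ hkA (a g x₀)
    rw [← hmul, inv_mul_cancel_right, hmul, hx₀ k hk] at hhg
    exact hEV (SetRel.prodMk_mem_comp (SetRel.prodMk_mem_comp hxg (SetRel.symm E hhg))
      (SetRel.symm E hxh))
  obtain ⟨π, hπ, hπR⟩ := exists_continuous_of_isClosed_graph hR hfst huniq
  refine ⟨π, hπ, fun x => ?_, fun g r => ?_⟩
  · obtain ⟨r, hr⟩ := hsnd x
    exact ⟨r, huniq r _ _ (hπR r) hr⟩
  · exact huniq _ _ _ (hπR _) (hRinv g _ (hπR r))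

end Universality

/-- `cLO(U_S)`, with the natural action of `iso(U_S)`, is the universal minimal flow
of `iso(U_S)` : the space is compact, the action is continuous and minimal, and every
compact Hausdorff minimal flow of `iso(U_S)` is a continuous equivariant image of it. -/
theorem cLOU_is_universal_minimal_flow
    (S : Set ℝ) (hScount : S.Countable) (hSpos : ∀ s ∈ S, 0 < s)
    (hacc : ∀ ε > 0, ∃ s ∈ S, s < ε) :
    CompactSpace (cLOU S) ∧
    Continuous (fun p : IsoU S × cLOU S => actU S p.1 p.2) ∧
    (∀ r : cLOU S, Dense (Set.range fun g : IsoU S => actU S g r)) ∧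
    (∀ (X : Type) [TopologicalSpace X] [CompactSpace X] [T2Space X] [Nonempty X]
      (a : IsoU S → X → X),
      (∀ x, a 1 x = x) →
      (∀ g h x, a (g * h) x = a g (a h x)) →
      (Continuous fun p : IsoU S × X => a p.1 p.2) →
      (∀ x : X, Dense (Set.range fun g : IsoU S => a g x)) →
      ∃ π : cLOU S → X, Continuous π ∧ Function.Surjective π ∧
        ∀ (g : IsoU S) (r : cLOU S), π (actU S g r) = a g (π r)) := by
  refine ⟨inferInstance, continuous_actU hSpos, dense_orbit_cLOU hSpos hacc, ?_⟩
  intro X _ _ _ _ a hone hmul hcont hdense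
  let _ : UniformSpace X := uniformSpaceOfCompactR1
  exact exists_equivariant_surjection hSpos hacc a hone hmul hcont hdense
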